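/- arXiv:1209.5654 — 11 statements merged into one kernel-verified Lean document; each statement's English description precedes it below -/
import Mathlib

section
/- Let E be a measurable space, let μ and ν be probability measures on E, and let G be a bounded measurable positive function on E satisfying G(x)/G(y) ≤ g for all x, y ∈ E, for some finite constant g. Then the Boltzmann-Gibbs transformations satisfy ‖Ψ_G(μ) − Ψ_G(ν)‖_tv ≤ g · ‖μ − ν‖_tv. -/
open MeasureTheory

variable {E : Type*}

/-- Total variation distance `‖μ − ν‖_tv = sup_A |μ(A) − ν(A)|`. -/
noncomputable def tvDist [MeasurableSpace E] (μ ν : Measure E) : ℝ :=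
  ⨆ A : {A : Set E // MeasurableSet A}, |(μ A.1).toReal - (ν A.1).toReal|

/-- The Boltzmann-Gibbs transformation `Ψ_G(μ)(A) = μ(G·1_A)/μ(G)`, as a measure. -/
noncomputable def BGtransf [MeasurableSpace E] (μ : Measure E) (G : E → ℝ) : Measure E :=
  (∫⁻ x, ENNReal.ofReal (G x) ∂μ)⁻¹ • μ.withDensity fun x => ENNReal.ofReal (G x)

lemma tv_bdd_aux [MeasurableSpace E] (μ ν : Measure E)
    [IsProbabilityMeasure μ] [IsProbabilityMeasure ν] :
    BddAbove (Set.range fun A : {A : Set E // MeasurableSet A} =>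
      |(μ A.1).toReal - (ν A.1).toReal|) := by
  refine ⟨1, ?_⟩
  rintro _ ⟨A, rfl⟩
  have h1 : (μ A.1).toReal ≤ 1 := measureReal_le_one (μ := μ)
  have h2 : (ν A.1).toReal ≤ 1 := measureReal_le_one (μ := ν)
  have h3 : 0 ≤ (μ A.1).toReal := ENNReal.toReal_nonneg
  have h4 : 0 ≤ (ν A.1).toReal := ENNReal.toReal_nonneg
  exact abs_le.2 ⟨by linarith, by linarith⟩

lemma tv_comm_aux [MeasurableSpace E] (μ ν : Measure E) : tvDist μ ν = tvDist ν μ := by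
  unfold tvDist
  congr 1
  funext A
  exact abs_sub_comm _ _

lemma integral_sub_le_aux [MeasurableSpace E] (μ ν : Measure E)
    [IsProbabilityMeasure μ] [IsProbabilityMeasure ν]
    (h : E → ℝ) (hm : Measurable h) (L : ℝ) (h0 : ∀ x, 0 ≤ h x) (hL : ∀ x, h x ≤ L) :
    ∫ x, h x ∂μ - ∫ x, h x ∂ν ≤ L * tvDist μ ν := by
  have hi : ∀ (ρ : Measure E) [IsFiniteMeasure ρ], Integrable h ρ := fun ρ _ =>
    Integrable.of_bound hm.aestronglyMeasurable L
      (Filter.Eventually.of_forall fun x => by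
        rw [Real.norm_eq_abs, abs_of_nonneg (h0 x)]; exact hL x)
  obtain ⟨x0⟩ : Nonempty E := nonempty_of_isProbabilityMeasure μ
  have hL0 : 0 ≤ L := (h0 x0).trans (hL x0)
  obtain ⟨S, hS, h1, h2⟩ := hahn_decomposition μ ν
  have r1 : ν.restrict S ≤ μ.restrict S := Measure.le_iff.2 fun t ht => by
    rw [Measure.restrict_apply ht, Measure.restrict_apply ht]
    exact h1 _ (ht.inter hS) Set.inter_subset_right
  have r2 : μ.restrict Sᶜ ≤ ν.restrict Sᶜ := Measure.le_iff.2 fun t ht => by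
    rw [Measure.restrict_apply ht, Measure.restrict_apply ht]
    exact h2 _ (ht.inter hS.compl) Set.inter_subset_right
  have i2 : ∫ x in Sᶜ, h x ∂μ ≤ ∫ x in Sᶜ, h x ∂ν :=
    integral_mono_measure r2 (Filter.Eventually.of_forall h0) (hi _)
  have i1 : ∫ x in S, (L - h x) ∂ν ≤ ∫ x in S, (L - h x) ∂μ :=
    integral_mono_measure r1 (Filter.Eventually.of_forall fun x => sub_nonneg.2 (hL x))
      ((integrable_const L).sub (hi _))
  rw [integral_sub (integrable_const L) (hi _), integral_sub (integrable_const L) (hi _),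
    setIntegral_const, setIntegral_const, smul_eq_mul, smul_eq_mul] at i1
  rw [← integral_add_compl hS (hi μ), ← integral_add_compl hS (hi ν)]
  have i3 : μ.real S - ν.real S ≤ tvDist μ ν :=
    (le_abs_self _).trans (le_ciSup (tv_bdd_aux μ ν) ⟨S, hS⟩)
  have := mul_le_mul_of_nonneg_left i3 hL0
  linarith

lemma bg_apply_aux [MeasurableSpace E] (μ : Measure E)
    (G : E → ℝ) (hGpos : ∀ x, 0 < G x) (hi : Integrable G μ)
    (A : Set E) (hA : MeasurableSet A) :
    (BGtransf μ G A).toReal = (∫ x in A, G x ∂μ) / ∫ x, G x ∂μ := by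
  unfold BGtransf
  rw [Measure.smul_apply, smul_eq_mul, withDensity_apply _ hA, ENNReal.toReal_mul,
    ENNReal.toReal_inv,
    integral_eq_lintegral_of_nonneg_ae (Filter.Eventually.of_forall fun x => (hGpos x).le)
      hi.aestronglyMeasurable,
    integral_eq_lintegral_of_nonneg_ae (Filter.Eventually.of_forall fun x => (hGpos x).le)
      hi.aestronglyMeasurable.restrict, div_eq_inv_mul]

lemma bg_one_side_aux [MeasurableSpace E]
    (μ ν : Measure E) [IsProbabilityMeasure μ] [IsProbabilityMeasure ν]
    (G : E → ℝ) (g : ℝ)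
    (hGmeas : Measurable G) (hGpos : ∀ x, 0 < G x) (hGbdd : ∃ C, ∀ x, G x ≤ C)
    (hratio : ∀ x y, G x / G y ≤ g) (A : Set E) (hA : MeasurableSet A) :
    (BGtransf μ G A).toReal - (BGtransf ν G A).toReal ≤ g * tvDist μ ν := by
  obtain ⟨C, hC⟩ := hGbdd
  have hi : ∀ (ρ : Measure E) [IsFiniteMeasure ρ], Integrable G ρ := fun ρ _ =>
    Integrable.of_bound hGmeas.aestronglyMeasurable C
      (Filter.Eventually.of_forall fun x => by
        rw [Real.norm_eq_abs, abs_of_pos (hGpos x)]; exact hC x)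
  have hpos : ∀ (ρ : Measure E) [IsProbabilityMeasure ρ], 0 < ∫ x, G x ∂ρ := fun ρ _ => by
    rw [integral_pos_iff_support_of_nonneg (fun x => (hGpos x).le) (hi ρ)]
    have : Function.support G = Set.univ := by
      ext x; simp [(hGpos x).ne']
    rw [this]; simp
  have hM : ∀ x, G x ≤ g * ∫ y, G y ∂μ := fun x => by
    have := integral_mono (μ := μ) (integrable_const (G x)) ((hi μ).const_mul g)
      (fun y => (div_le_iff₀ (hGpos y)).1 (hratio x y))
    rw [integral_const_mul] at this
    simpa using this
  rw [bg_apply_aux μ G hGpos (hi μ) A hA, bg_apply_aux ν G hGpos (hi ν) A hA]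
  have hmp := hpos μ
  have hnp := hpos ν
  set a := ∫ x, G x ∂μ with ha
  set b := ∫ x, G x ∂ν with hb
  set c := (∫ x in A, G x ∂ν) / b with hc
  have hc0 : 0 ≤ c := div_nonneg (integral_nonneg fun x => (hGpos x).le) hnp.le
  have hc1 : c ≤ 1 := (div_le_one hnp).2
    (setIntegral_le_integral (hi ν) (Filter.Eventually.of_forall fun x => (hGpos x).le))
  have hcb : ∫ x in A, G x ∂ν = c * b := by rw [hc]; field_simp
  have key := integral_sub_le_aux μ ν (fun x => A.indicator G x - c * G x + c * (g * a))
    (((hGmeas.indicator hA).sub (hGmeas.const_mul c)).add_const _) (g * a)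
    (fun x => by
      have h1 := hM x
      have h2 := hGpos x
      by_cases hx : x ∈ A
      · simp only [Set.indicator_of_mem hx]; nlinarith
      · simp only [Set.indicator_of_notMem hx]; nlinarith)
    (fun x => by
      have h1 := hM x
      have h2 := hGpos x
      by_cases hx : x ∈ A
      · simp only [Set.indicator_of_mem hx]; nlinarith
      · simp only [Set.indicator_of_notMem hx]; nlinarith)
  have hint : ∀ (ρ : Measure E) [IsProbabilityMeasure ρ],
      ∫ x, (A.indicator G x - c * G x + c * (g * a)) ∂ρ
        = ∫ x in A, G x ∂ρ - c * ∫ x, G x ∂ρ + c * (g * a) := fun ρ _ => by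
    have hsub : Integrable (fun x => A.indicator G x - c * G x) ρ :=
      ((hi ρ).indicator hA).sub ((hi ρ).const_mul c)
    rw [integral_add hsub (integrable_const _),
      integral_sub ((hi ρ).indicator hA) ((hi ρ).const_mul c), integral_indicator hA,
      integral_const_mul]
    simp
  rw [hint μ, hint ν, hcb, ← ha, ← hb] at key
  rw [sub_le_iff_le_add, div_le_iff₀ hmp]
  linarith

/-- If `G` is a bounded measurable positive function with
`G(x)/G(y) ≤ g` for all `x, y`, then for any probability measures `μ`, `ν`,
`‖Ψ_G(μ) − Ψ_G(ν)‖_tv ≤ g · ‖μ − ν‖_tv`. -/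
theorem bg_tv_lipschitz [MeasurableSpace E]
    (μ ν : Measure E) [IsProbabilityMeasure μ] [IsProbabilityMeasure ν]
    (G : E → ℝ) (g : ℝ)
    (hGmeas : Measurable G) (hGpos : ∀ x, 0 < G x) (hGbdd : ∃ C, ∀ x, G x ≤ C)
    (hratio : ∀ x y, G x / G y ≤ g) :
    tvDist (BGtransf μ G) (BGtransf ν G) ≤ g * tvDist μ ν := by
  obtain ⟨x0⟩ : Nonempty E := nonempty_of_isProbabilityMeasure μ
  haveI : Nonempty {A : Set E // MeasurableSet A} := ⟨⟨∅, MeasurableSet.empty⟩⟩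
  refine ciSup_le fun A => abs_le.2 ⟨?_, ?_⟩
  · have := bg_one_side_aux ν μ G g hGmeas hGpos hGbdd hratio A.1 A.2
    rw [tv_comm_aux ν μ] at this
    linarith
  · exact bg_one_side_aux μ ν G g hGmeas hGpos hGbdd hratio A.1 A.2
end

section
/- Let K be a Markov kernel on a measurable space E and let G be a bounded measurable positive function on E satisfying sup_{x,y ∈ E} G(x)/G(y) ≤ g for some finite constant g. Then sup_{x,y ∈ E} (K.G)(x)/(K.G)(y) ≤ 1 + β(K)·(g − 1), where K.G(x) = ∫ G(u) K(x,du). -/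
open MeasureTheory ProbabilityTheory

variable {E : Type*}

/-- Dobrushin-type ergodic coefficient of a set function `P`,
`β(P) = sup { |P(x,A) - P(y,A)| : x, y ∈ E, A measurable }`. -/
noncomputable def dobF [MeasurableSpace E] (P : E → Set E → ℝ) : ℝ :=
  ⨆ q : E × E × {A : Set E // MeasurableSet A}, |P q.1 q.2.2.1 - P q.2.1 q.2.2.1|

/-- The set function associated with a Markov kernel. -/
noncomputable def kernelSF [MeasurableSpace E] (K : Kernel E E) : E → Set E → ℝ :=
  fun x A => (K x A).toReal

/-- If `K` is a Markov kernel and `G` a bounded measurable positive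
function with `sup_{x,y} G(x)/G(y) ≤ g`, then
`sup_{x,y} (K.G)(x)/(K.G)(y) ≤ 1 + β(K)·(g − 1)`, where `K.G(x) = ∫ G(u) K(x,du)`. -/
theorem kernel_ratio_bound [MeasurableSpace E]
    (K : Kernel E E) [IsMarkovKernel K]
    (G : E → ℝ) (g : ℝ)
    (hGmeas : Measurable G) (hGpos : ∀ x, 0 < G x) (hGbdd : ∃ C, ∀ x, G x ≤ C)
    (hratio : ∀ x y, G x / G y ≤ g) :
    ∀ x y, (∫ u, G u ∂(K x)) / (∫ u, G u ∂(K y)) ≤ 1 + dobF (kernelSF K) * (g - 1) := by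
  intro x y
  obtain ⟨C, hC⟩ := hGbdd
  have hg1 : 1 ≤ g := by
    have := hratio x x
    rwa [div_self (hGpos x).ne'] at this
  have hgpos : 0 < g := by linarith
  haveI : Nonempty E := ⟨x⟩
  set β := dobF (kernelSF K) with hβ
  have hbd : BddAbove (Set.range fun q : E × E × {A : Set E // MeasurableSet A} =>
      |kernelSF K q.1 q.2.2.1 - kernelSF K q.2.1 q.2.2.1|) := by
    refine ⟨1, ?_⟩
    rintro _ ⟨q, rfl⟩
    have h0 : ∀ a A, 0 ≤ kernelSF K a A := fun a A => ENNReal.toReal_nonneg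
    have h1 : ∀ a A, kernelSF K a A ≤ 1 := fun a A => measureReal_le_one (μ := K a)
    have a1 := h0 q.1 q.2.2.1
    have a2 := h0 q.2.1 q.2.2.1
    have a3 := h1 q.1 q.2.2.1
    have a4 := h1 q.2.1 q.2.2.1
    exact abs_le.2 ⟨by linarith, by linarith⟩
  have hA : ∀ A, MeasurableSet A → (K x).real A ≤ (K y).real A + β := by
    intro A hA
    have h1 : |(K x).real A - (K y).real A| ≤ β := le_ciSup hbd (x, y, ⟨A, hA⟩)
    linarith [le_abs_self ((K x).real A - (K y).real A)]
  have hβ0 : 0 ≤ β := by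
    have := hA ∅ MeasurableSet.empty
    simpa using this
  have hbelow : BddBelow (Set.range G) := ⟨0, by rintro _ ⟨u, rfl⟩; exact (hGpos u).le⟩
  set m := ⨅ u, G u with hm
  have hmle : ∀ u, m ≤ G u := fun u => ciInf_le hbelow u
  have hle : ∀ u, G u ≤ g * m := by
    intro u
    have : G u / g ≤ m := by
      refine le_ciInf fun v => ?_
      have := hratio u v
      rw [div_le_iff₀ (hGpos v)] at this
      rw [div_le_iff₀ hgpos]
      linarith
    rw [div_le_iff₀ hgpos] at this
    linarith
  have hmpos : 0 < m := by
    have := (hGpos x).trans_le (hle x)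
    exact pos_of_mul_pos_right this hgpos.le
  have hint : ∀ z, Integrable G (K z) := by
    intro z
    refine Integrable.of_bound hGmeas.aestronglyMeasurable C (Filter.Eventually.of_forall fun u => ?_)
    rw [Real.norm_eq_abs, abs_of_pos (hGpos u)]
    exact hC u
  have hM0 : 0 ≤ (g - 1) * m := mul_nonneg (by linarith) hmpos.le
  have hlc : ∀ z, ∫ u, G u ∂(K z) - m
      = ∫ t in Set.Ioc 0 ((g - 1) * m), (K z).real {a | t ≤ G a - m} := by
    intro z
    rw [← Integrable.integral_eq_integral_Ioc_meas_le (f := fun u => G u - m)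
      ((hint z).sub (integrable_const m))
      (Filter.Eventually.of_forall fun u => sub_nonneg.2 (hmle u))
      (Filter.Eventually.of_forall fun u => by
        have := hle u
        show G u - m ≤ (g - 1) * m
        linarith)]
    rw [integral_sub (hint z) (integrable_const m)]
    simp
  have hanti : ∀ z, IntegrableOn (fun t => (K z).real {a | t ≤ G a - m})
      (Set.Ioc 0 ((g - 1) * m)) := by
    intro z
    have : Antitone (fun t => (K z).real {a | t ≤ G a - m}) := fun s t hst =>
      measureReal_mono (fun a (ha : t ≤ G a - m) => hst.trans ha)
    exact (this.locallyIntegrable.integrableOn_isCompact isCompact_Icc).mono_set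
      Set.Ioc_subset_Icc_self
  have hkey : ∫ u, G u ∂(K x) - m ≤ ∫ u, G u ∂(K y) - m + β * ((g - 1) * m) := by
    rw [hlc x, hlc y]
    have hc : IntegrableOn (fun _ : ℝ => β) (Set.Ioc 0 ((g - 1) * m)) :=
      integrableOn_const (by simp)
    have h2 : ∫ t in Set.Ioc 0 ((g - 1) * m), (K x).real {a | t ≤ G a - m}
      ≤ ∫ t in Set.Ioc 0 ((g - 1) * m), ((K y).real {a | t ≤ G a - m} + β) :=
      integral_mono (hanti x) ((hanti y).add hc) fun t =>
        hA _ (measurableSet_le measurable_const (hGmeas.sub_const m))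
    rw [integral_add (hanti y) hc] at h2
    have h3 : ∫ t in Set.Ioc 0 ((g - 1) * m), β = β * ((g - 1) * m) := by
      rw [setIntegral_const, Real.volume_real_Ioc_of_le hM0, smul_eq_mul]
      ring
    linarith
  have hy : m ≤ ∫ u, G u ∂(K y) := by
    have := integral_mono (integrable_const m) (hint y) hmle
    simpa using this
  rw [div_le_iff₀ (hmpos.trans_le hy)]
  have := mul_le_mul_of_nonneg_left hy (mul_nonneg hβ0 (sub_nonneg.2 hg1))
  nlinarith
end

section
/- Let M be a Markov kernel on a measurable space E and let Q be a (not necessarily normalized) positive bounded integral operator on E satisfying sup_{x,y ∈ E} (Q.1)(x)/(Q.1)(y) ≤ g for some finite constant g ≥ 1, where 1 is the constant function one. Define the Markov kernels P and P′ by P.f(x) = (M.Q.f)(x)/(M.Q.1)(x) and P′.f(x) = (Q.f)(x)/(Q.1)(x). Then β(P) ≤ g · β(M) · β(P′). -/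
open MeasureTheory ProbabilityTheory

variable {E : Type*}

lemma aux_tv [MeasurableSpace E] (μ ν : Measure E) [IsProbabilityMeasure μ]
    [IsProbabilityMeasure ν] (t B : ℝ) (hB : 0 ≤ B)
    (ht : ∀ A, MeasurableSet A → μ.real A - ν.real A ≤ t)
    (f : E → ℝ) (hf : Measurable f) (h0 : ∀ x, 0 ≤ f x) (h1 : ∀ x, f x ≤ B) :
    ∫ x, f x ∂μ - ∫ x, f x ∂ν ≤ B * t := by
  have hint : ∀ (m : Measure E) [IsProbabilityMeasure m], Integrable f m := fun m _ =>
    Integrable.of_bound hf.aestronglyMeasurable B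
      (Filter.Eventually.of_forall fun x => by
        rw [Real.norm_eq_abs, abs_of_nonneg (h0 x)]; exact h1 x)
  have hanti : ∀ (m : Measure E) [IsProbabilityMeasure m],
      IntegrableOn (fun s : ℝ => m.real {a | s ≤ f a}) (Set.Ioc 0 B) volume := by
    intro m _
    have : Antitone (fun s : ℝ => m.real {a | s ≤ f a}) := fun s s' hs =>
      measureReal_mono (fun a (ha : s' ≤ f a) => le_trans hs ha)
    exact (this.intervalIntegrable (a := 0) (b := B)).1
  rw [(hint μ).integral_eq_integral_Ioc_meas_le (Filter.Eventually.of_forall h0)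
      (Filter.Eventually.of_forall h1),
    (hint ν).integral_eq_integral_Ioc_meas_le (Filter.Eventually.of_forall h0)
      (Filter.Eventually.of_forall h1), ← integral_sub (hanti μ) (hanti ν)]
  calc _ ≤ ∫ s in Set.Ioc 0 B, t := by
        apply integral_mono ((hanti μ).sub (hanti ν)) (by simp)
        intro s
        exact ht _ (measurableSet_le measurable_const hf)
    _ = B * t := by simp [hB]

lemma aux_norm [MeasurableSpace E] (μ ν : Measure E) [IsProbabilityMeasure μ]
    [IsProbabilityMeasure ν] (t b g : ℝ) (hb : 0 ≤ b) (hg : 0 ≤ g)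
    (ht : ∀ A, MeasurableSet A → μ.real A - ν.real A ≤ t)
    (h f : E → ℝ) (hh : Measurable h) (hh0 : ∀ x, 0 ≤ h x)
    (hf : Measurable f) (h0 : ∀ x, 0 ≤ f x) (h1 : ∀ x, f x ≤ b)
    (hν : 0 < ∫ x, h x ∂ν) (hle : ∫ x, h x ∂ν ≤ ∫ x, h x ∂μ)
    (hgb : ∀ x, h x ≤ g * ∫ x, h x ∂μ) :
    (∫ x, h x * f x ∂μ) / (∫ x, h x ∂μ) - (∫ x, h x * f x ∂ν) / (∫ x, h x ∂ν)
      ≤ g * t * b := by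
  have hμ := hν.trans_le hle
  have key := aux_tv μ ν t (g * (∫ x, h x ∂μ) * b) (by positivity) ht (fun x => h x * f x)
    (hh.mul hf) (fun x => mul_nonneg (hh0 x) (h0 x))
    (fun x => mul_le_mul (hgb x) (h1 x) (h0 x) (by positivity))
  have hn : 0 ≤ ∫ x, h x * f x ∂ν := integral_nonneg fun x => mul_nonneg (hh0 x) (h0 x)
  calc _ ≤ (∫ x, h x * f x ∂μ) / (∫ x, h x ∂μ) - (∫ x, h x * f x ∂ν) / (∫ x, h x ∂μ) := by
        gcongr
    _ = (∫ x, h x * f x ∂μ - ∫ x, h x * f x ∂ν) / (∫ x, h x ∂μ) := by ring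
    _ ≤ g * t * b := by
        rw [div_le_iff₀ hμ]
        refine key.trans (le_of_eq (by ring))

lemma aux_abs [MeasurableSpace E] (μ ν : Measure E) [IsProbabilityMeasure μ]
    [IsProbabilityMeasure ν] (t b g c : ℝ) (hb : 0 ≤ b) (hg : 0 ≤ g)
    (ht : ∀ A, MeasurableSet A → μ.real A - ν.real A ≤ t)
    (h r : E → ℝ) (hh : Measurable h) (hh0 : ∀ x, 0 ≤ h x)
    (hr : Measurable r) (h0 : ∀ x, c ≤ r x) (h1 : ∀ x, r x ≤ c + b)
    (hν : 0 < ∫ x, h x ∂ν) (hle : ∫ x, h x ∂ν ≤ ∫ x, h x ∂μ)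
    (hgb : ∀ x, h x ≤ g * ∫ x, h x ∂μ) :
    |(∫ x, h x * r x ∂μ) / (∫ x, h x ∂μ) - (∫ x, h x * r x ∂ν) / (∫ x, h x ∂ν)|
      ≤ g * t * b := by
  have hμ := hν.trans_le hle
  have hi : ∀ (m : Measure E) [IsProbabilityMeasure m], Integrable h m := fun m _ =>
    Integrable.of_bound hh.aestronglyMeasurable (g * ∫ x, h x ∂μ)
      (Filter.Eventually.of_forall fun x => by
        rw [Real.norm_eq_abs, abs_of_nonneg (hh0 x)]; exact hgb x)
  have hir : ∀ (m : Measure E) [IsProbabilityMeasure m], Integrable (fun x => h x * r x) m :=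
    fun m _ => (hi m).mul_bdd (c := |c| + b) hr.aestronglyMeasurable
      (Filter.Eventually.of_forall fun x => by
        rw [Real.norm_eq_abs, abs_le]
        have := h0 x
        have := h1 x
        have := neg_abs_le c
        have := le_abs_self c
        constructor <;> linarith)
  have e1 : ∀ (m : Measure E) [IsProbabilityMeasure m],
      ∫ x, h x * (r x - c) ∂m = ∫ x, h x * r x ∂m - c * ∫ x, h x ∂m := by
    intro m _
    rw [← integral_const_mul, ← integral_sub (hir m) ((hi m).const_mul c)]
    congr 1; ext x; ring
  have e2 : ∀ (m : Measure E) [IsProbabilityMeasure m],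
      ∫ x, h x * (c + b - r x) ∂m = (c + b) * ∫ x, h x ∂m - ∫ x, h x * r x ∂m := by
    intro m _
    rw [← integral_const_mul, ← integral_sub ((hi m).const_mul (c + b)) (hir m)]
    congr 1; ext x; ring
  have k1 := aux_norm μ ν t b g hb hg ht h (fun x => r x - c) hh hh0 (hr.sub_const c)
    (fun x => by linarith [h0 x]) (fun x => by linarith [h1 x]) hν hle hgb
  have k2 := aux_norm μ ν t b g hb hg ht h (fun x => c + b - r x) hh hh0 (hr.const_sub (c + b))
    (fun x => by linarith [h1 x]) (fun x => by linarith [h0 x]) hν hle hgb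
  simp only [e1, e2, sub_div, mul_div_cancel_right₀ _ hμ.ne',
    mul_div_cancel_right₀ _ hν.ne'] at k1 k2
  rw [abs_le]
  constructor <;> linarith

lemma le_dobF [MeasurableSpace E] (P : E → Set E → ℝ) (h0 : ∀ x A, 0 ≤ P x A)
    (h1 : ∀ x A, P x A ≤ 1) (x y : E) (A : Set E) (hA : MeasurableSet A) :
    |P x A - P y A| ≤ dobF P := by
  refine le_ciSup (f := fun q : E × E × {A : Set E // MeasurableSet A} =>
    |P q.1 q.2.2.1 - P q.2.1 q.2.2.1|) ⟨1, ?_⟩ (x, y, ⟨A, hA⟩)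
  rintro _ ⟨q, rfl⟩
  simp only
  rw [abs_le]
  constructor <;> linarith [h0 q.1 q.2.2.1, h1 q.1 q.2.2.1, h0 q.2.1 q.2.2.1, h1 q.2.1 q.2.2.1]

/-- Let `M` be a Markov kernel and `Q` a positive bounded integral
operator (a finite kernel with positive total masses) satisfying
`sup_{x,y} (Q.1)(x)/(Q.1)(y) ≤ g` for some `g ≥ 1`. With
`P(x,A) = (M.Q.1_A)(x)/(M.Q.1)(x)` and `P′(x,A) = (Q.1_A)(x)/(Q.1)(x)`, one has
`β(P) ≤ g · β(M) · β(P′)`. -/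
theorem normalized_kernel_dobrushin_bound [MeasurableSpace E]
    (M Q : Kernel E E) [IsMarkovKernel M] [IsFiniteKernel Q]
    (hQpos : ∀ x, 0 < Q x Set.univ)
    (g : ℝ) (hg : 1 ≤ g)
    (hratio : ∀ x y, (Q x Set.univ).toReal ≤ g * (Q y Set.univ).toReal) :
    dobF (fun x A => (∫ y, (Q y A).toReal ∂(M x)) / ∫ y, (Q y Set.univ).toReal ∂(M x)) ≤
      g * dobF (kernelSF M) *
        dobF (fun x A => (Q x A).toReal / (Q x Set.univ).toReal) := by
  have hD0 : ∀ P : E → Set E → ℝ, 0 ≤ dobF P := fun P => Real.iSup_nonneg fun _ => abs_nonneg _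
  have hg0 : 0 ≤ g := by linarith
  have hpos : ∀ x, 0 < (Q x Set.univ).toReal := fun x =>
    ENNReal.toReal_pos (hQpos x).ne' (measure_ne_top _ _)
  have hmeas : ∀ A, MeasurableSet A → Measurable fun y => (Q y A).toReal := fun A hA =>
    (Q.measurable_coe hA).ennreal_toReal
  refine Real.iSup_le ?_ (mul_nonneg (mul_nonneg hg0 (hD0 _)) (hD0 _))
  rintro ⟨x, y, A, hA⟩
  simp only
  set b := dobF (fun x A => (Q x A).toReal / (Q x Set.univ).toReal) with hb
  set t := dobF (kernelSF M) with ht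
  have hM : ∀ x y A, MeasurableSet A → (M x).real A - (M y).real A ≤ t := fun x y A hA =>
    (le_abs_self _).trans (le_dobF (kernelSF M) (fun _ _ => ENNReal.toReal_nonneg)
      (fun x A => measureReal_le_one (μ := M x)) x y A hA)
  have hR : ∀ x y, (Q x A).toReal / (Q x Set.univ).toReal
      - (Q y A).toReal / (Q y Set.univ).toReal ≤ b := fun x y =>
    (le_abs_self _).trans (le_dobF (fun x A => (Q x A).toReal / (Q x Set.univ).toReal)
      (fun _ _ => by positivity)
      (fun x A => div_le_one_of_le₀ (measureReal_mono (μ := Q x) (Set.subset_univ A))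
        (hpos x).le) x y A hA)
  set r : E → ℝ := fun x => (Q x A).toReal / (Q x Set.univ).toReal with hr
  set h : E → ℝ := fun x => (Q x Set.univ).toReal with hh
  have hrm : Measurable r := (hmeas A hA).div (hmeas _ MeasurableSet.univ)
  have hQA : ∀ y, (Q y A).toReal = h y * r y := fun y => by
    simp only [hr, hh]
    rw [mul_div_cancel₀ _ (hpos y).ne']
  have hint : ∀ z, Integrable h (M z) := fun z =>
    Integrable.of_bound (hmeas _ MeasurableSet.univ).aestronglyMeasurable (g * h x)
      (Filter.Eventually.of_forall fun w => by
        rw [Real.norm_eq_abs, abs_of_nonneg (hpos w).le]; exact hratio w x)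
  have hgb : ∀ z w, h w ≤ g * ∫ v, h v ∂(M z) := by
    intro z w
    rw [← integral_const_mul]
    calc h w = ∫ v, h w ∂(M z) := by simp
      _ ≤ _ := integral_mono (by simp) ((hint z).const_mul g) (fun v => hratio w v)
  have hip : ∀ z, 0 < ∫ v, h v ∂(M z) := by
    intro z
    have h1 := (hpos x).trans_le (hgb z x)
    exact pos_of_mul_pos_right h1 hg0
  have hbdd : BddBelow (Set.range r) := ⟨0, by rintro _ ⟨z, rfl⟩; simp only [hr]; positivity⟩
  haveI : Nonempty E := ⟨x⟩
  have hc0 : ∀ z, ⨅ w, r w ≤ r z := fun z => ciInf_le hbdd z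
  have hc1 : ∀ z, r z ≤ (⨅ w, r w) + b := fun z => by
    have : r z - b ≤ ⨅ w, r w := le_ciInf fun w => by linarith [hR z w]
    linarith
  simp only [hQA]
  rcases le_total (∫ v, h v ∂(M y)) (∫ v, h v ∂(M x)) with hle | hle
  · exact aux_abs (M x) (M y) t b g _ (hD0 _) hg0 (hM x y) h r (hmeas _ MeasurableSet.univ)
      (fun z => (hpos z).le) hrm hc0 hc1 (hip y) hle (hgb x)
  · rw [abs_sub_comm]
    exact aux_abs (M y) (M x) t b g _ (hD0 _) hg0 (hM y x) h r (hmeas _ MeasurableSet.univ)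
      (fun z => (hpos z).le) hrm hc0 hc1 (hip x) hle (hgb y)
end

section
/- Let (G_p) be bounded measurable positive potential functions and (M_p) Markov kernels on a measurable space E, with associated Feynman-Kac quantities b_k, g_{k,n}, b_{p,n} as defined below. Then for all integers p ≤ n, b_{p,n} ≤ Π_{k=p+1}^{n} b_k · g_{k,n}. -/
open MeasureTheory ProbabilityTheory

variable {E : Type*}

/-- `ratioSup F = sup_{x,y} F(x)/F(y)`. -/
noncomputable def ratioSup (F : E → ℝ) : ℝ :=
  ⨆ q : E × E, F q.1 / F q.2

/-- The Feynman-Kac integral operator `Q_p f = G_p · (M_p.f)`. -/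
noncomputable def Qop [MeasurableSpace E] (G : ℕ → E → ℝ) (M : ℕ → Kernel E E)
    (p : ℕ) (f : E → ℝ) (x : E) : ℝ :=
  G p x * ∫ y, f y ∂(M p x)

/-- `Qiter G M p k = Q_{p+1} Q_{p+2} ⋯ Q_{p+k}` (as an operator on functions). -/
noncomputable def Qiter [MeasurableSpace E] (G : ℕ → E → ℝ) (M : ℕ → Kernel E E) :
    ℕ → ℕ → (E → ℝ) → E → ℝ
  | _, 0, f => f
  | p, k + 1, f => Qop G M (p + 1) (Qiter G M (p + 1) k f)

/-- The semigroup operator `Q_{p,n} = Q_{p+1} Q_{p+2} ⋯ Q_n` (for `p ≤ n`). -/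
noncomputable def Qpn [MeasurableSpace E] (G : ℕ → E → ℝ) (M : ℕ → Kernel E E)
    (p n : ℕ) (f : E → ℝ) : E → ℝ :=
  Qiter G M p (n - p) f

/-- `G_{p,n} = Q_{p,n}.1`. -/
noncomputable def Gpn [MeasurableSpace E] (G : ℕ → E → ℝ) (M : ℕ → Kernel E E)
    (p n : ℕ) : E → ℝ :=
  Qpn G M p n (fun _ => 1)

/-- `g_{p,n} = sup_{x,y} G_{p,n}(x)/G_{p,n}(y)`. -/
noncomputable def gpn [MeasurableSpace E] (G : ℕ → E → ℝ) (M : ℕ → Kernel E E)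
    (p n : ℕ) : ℝ :=
  ratioSup (Gpn G M p n)

/-- `g_k = sup_{x,y} G_k(x)/G_k(y)`. -/
noncomputable def glit (G : ℕ → E → ℝ) (k : ℕ) : ℝ := ratioSup (G k)

/-- `b_k = β(M_k)`, the Dobrushin ergodic coefficient of the Markov kernel `M_k`. -/
noncomputable def blit [MeasurableSpace E] (M : ℕ → Kernel E E) (k : ℕ) : ℝ :=
  dobF (kernelSF (M k))

/-- The Markov set function `P_{p,n}(x,A) = (Q_{p,n}.1_A)(x) / (Q_{p,n}.1)(x)`. -/
noncomputable def Ppn [MeasurableSpace E] (G : ℕ → E → ℝ) (M : ℕ → Kernel E E)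
    (p n : ℕ) : E → Set E → ℝ :=
  fun x A => Qpn G M p n (A.indicator fun _ => 1) x / Gpn G M p n x

/-- `b_{p,n} = β(P_{p,n})`. -/
noncomputable def bpn [MeasurableSpace E] (G : ℕ → E → ℝ) (M : ℕ → Kernel E E)
    (p n : ℕ) : ℝ :=
  dobF (Ppn G M p n)


theorem fk_aux_tv [MeasurableSpace E] (μ ν : Measure E) [IsProbabilityMeasure μ]
    [IsProbabilityMeasure ν] (b U : ℝ) (hU : 0 ≤ U)
    (hb : ∀ A, MeasurableSet A → (μ A).toReal - (ν A).toReal ≤ b)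
    (u : E → ℝ) (hu : Measurable u) (hu0 : ∀ x, 0 ≤ u x) (huU : ∀ x, u x ≤ U) :
    ∫ x, u x ∂μ - ∫ x, u x ∂ν ≤ b * U := by
  have hint : ∀ (ρ : Measure E) [IsProbabilityMeasure ρ], Integrable u ρ := fun ρ _ =>
    Integrable.of_bound hu.aestronglyMeasurable U
      (Filter.Eventually.of_forall fun x => by
        rw [Real.norm_eq_abs, abs_of_nonneg (hu0 x)]; exact huU x)
  have hlay : ∀ (ρ : Measure E) [IsProbabilityMeasure ρ],
      ∫ x, u x ∂ρ = ∫ t in Set.Ioc 0 U, ρ.real {a | t ≤ u a} := fun ρ _ =>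
    (hint ρ).integral_eq_integral_Ioc_meas_le (Filter.Eventually.of_forall hu0)
      (Filter.Eventually.of_forall huU)
  have hI : ∀ (ρ : Measure E) [IsProbabilityMeasure ρ],
      IntegrableOn (fun t => ρ.real {a | t ≤ u a}) (Set.Ioc 0 U) := by
    intro ρ _
    have hanti : Antitone (fun t => ρ.real {a | t ≤ u a}) := fun s t hst =>
      measureReal_mono (fun a (ha : t ≤ u a) => le_trans hst ha)
    refine Integrable.of_bound hanti.measurable.aestronglyMeasurable 1
      (Filter.Eventually.of_forall fun x => ?_)
    rw [Real.norm_eq_abs, abs_of_nonneg measureReal_nonneg]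
    exact measureReal_le_one
  rw [hlay μ, hlay ν, ← integral_sub (hI μ) (hI ν)]
  calc _ ≤ ∫ t in Set.Ioc 0 U, b := by
        apply integral_mono ((hI μ).sub (hI ν)) (integrable_const b)
        intro t
        exact hb _ (measurableSet_le measurable_const hu)
    _ = b * U := by simp [hU, mul_comm]

theorem fk_aux_step [MeasurableSpace E] [Nonempty E] (μ ν : Measure E) [IsProbabilityMeasure μ]
    [IsProbabilityMeasure ν] (b g c H : ℝ) (hb0 : 0 ≤ b) (hc : 0 ≤ c)
    (hb : ∀ A, MeasurableSet A → (μ A).toReal - (ν A).toReal ≤ b)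
    (h f : E → ℝ) (hh : Measurable h) (hf : Measurable f) (hpos : ∀ x, 0 < h x)
    (hH : ∀ x, h x ≤ H) (hg : ∀ x y, h x ≤ g * h y)
    (hosc : ∀ x y, f x - f y ≤ c)
    (hle : ∫ x, h x ∂ν ≤ ∫ x, h x ∂μ) (hν : 0 < ∫ x, h x ∂ν) :
    (∫ x, h x * f x ∂μ) / (∫ x, h x ∂μ) - (∫ x, h x * f x ∂ν) / (∫ x, h x ∂ν) ≤ b * g * c := by
  have x0 : E := Classical.arbitrary E
  have hbb : BddBelow (Set.range f) := ⟨f x0 - c, by rintro _ ⟨y, rfl⟩; linarith [hosc x0 y]⟩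
  set m := ⨅ x, f x with hm
  have hf0 : ∀ x, 0 ≤ f x - m := fun x => by linarith [ciInf_le hbb x]
  have hfc : ∀ x, f x - m ≤ c := fun x => by
    have : f x - c ≤ m := le_ciInf fun y => by linarith [hosc x y]
    linarith
  have hhb : BddAbove (Set.range h) := ⟨H, by rintro _ ⟨y, rfl⟩; exact hH y⟩
  set S := ⨆ x, h x with hS
  have hhS : ∀ x, h x ≤ S := fun x => le_ciSup hhb x
  have hS0 : 0 < S := (hpos x0).trans_le (hhS x0)
  have hSg : ∀ y, S ≤ g * h y := fun y => ciSup_le fun x => hg x y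
  have hih : ∀ (ρ : Measure E) [IsProbabilityMeasure ρ], Integrable h ρ := fun ρ _ =>
    Integrable.of_bound hh.aestronglyMeasurable S
      (Filter.Eventually.of_forall fun x => by
        rw [Real.norm_eq_abs, abs_of_pos (hpos x)]; exact hhS x)
  have hu0 : ∀ x, 0 ≤ h x * (f x - m) := fun x => mul_nonneg (hpos x).le (hf0 x)
  have huU : ∀ x, h x * (f x - m) ≤ S * c := fun x =>
    mul_le_mul (hhS x) (hfc x) (hf0 x) hS0.le
  have hum : Measurable fun x => h x * (f x - m) := hh.mul (hf.sub_const m)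
  have hiu : ∀ (ρ : Measure E) [IsProbabilityMeasure ρ],
      Integrable (fun x => h x * (f x - m)) ρ := fun ρ _ =>
    Integrable.of_bound hum.aestronglyMeasurable (S * c)
      (Filter.Eventually.of_forall fun x => by
        rw [Real.norm_eq_abs, abs_of_nonneg (hu0 x)]; exact huU x)
  have hdec : ∀ (ρ : Measure E) [IsProbabilityMeasure ρ],
      ∫ x, h x * f x ∂ρ = ∫ x, h x * (f x - m) ∂ρ + m * ∫ x, h x ∂ρ := fun ρ _ => by
    rw [← integral_const_mul, ← integral_add (hiu ρ) ((hih ρ).const_mul m)]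
    congr 1; ext x; ring
  have htv := fk_aux_tv μ ν b (S * c) (by positivity) hb _ hum hu0 huU
  have hμ := hν.trans_le hle
  have hSμ : S ≤ g * ∫ x, h x ∂μ := by
    rw [← integral_const_mul]
    calc S = ∫ _, S ∂μ := by simp
      _ ≤ _ := integral_mono (integrable_const S) ((hih μ).const_mul g) hSg
  have hn : 0 ≤ ∫ x, h x * (f x - m) ∂ν := integral_nonneg hu0
  rw [hdec μ, hdec ν, add_div, add_div, mul_div_cancel_right₀ _ hμ.ne',
    mul_div_cancel_right₀ _ hν.ne']
  have h1 : (∫ x, h x * (f x - m) ∂ν) / (∫ x, h x ∂μ) ≤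
      (∫ x, h x * (f x - m) ∂ν) / (∫ x, h x ∂ν) := by gcongr
  have h2 : (∫ x, h x * (f x - m) ∂μ) / (∫ x, h x ∂μ) -
      (∫ x, h x * (f x - m) ∂ν) / (∫ x, h x ∂μ) ≤ b * g * c := by
    rw [← sub_div, div_le_iff₀ hμ]
    have := mul_le_mul_of_nonneg_left hSμ (mul_nonneg hb0 hc)
    nlinarith
  linarith

theorem fk_aux_step2 [MeasurableSpace E] [Nonempty E] (μ ν : Measure E) [IsProbabilityMeasure μ]
    [IsProbabilityMeasure ν] (b g c H : ℝ) (hb0 : 0 ≤ b) (hc : 0 ≤ c)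
    (hb : ∀ A, MeasurableSet A → |(μ A).toReal - (ν A).toReal| ≤ b)
    (h f : E → ℝ) (hh : Measurable h) (hf : Measurable f) (hpos : ∀ x, 0 < h x)
    (hH : ∀ x, h x ≤ H) (hg : ∀ x y, h x ≤ g * h y)
    (hosc : ∀ x y, f x - f y ≤ c)
    (hμ : 0 < ∫ x, h x ∂μ) (hν : 0 < ∫ x, h x ∂ν) :
    (∫ x, h x * f x ∂μ) / (∫ x, h x ∂μ) - (∫ x, h x * f x ∂ν) / (∫ x, h x ∂ν) ≤ b * g * c := by
  rcases le_total (∫ x, h x ∂ν) (∫ x, h x ∂μ) with hle | hle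
  · exact fk_aux_step μ ν b g c H hb0 hc (fun A hA => (abs_le.1 (hb A hA)).2) h f hh hf hpos hH hg
      hosc hle hν
  · have := fk_aux_step ν μ b g c H hb0 hc
      (fun A hA => by linarith [(abs_le.1 (hb A hA)).1]) h (fun x => - f x) hh hf.neg hpos hH hg
      (fun x y => by linarith [hosc y x]) hle hμ
    simp only [mul_neg, integral_neg, neg_div] at this
    linarith

theorem fk_aux_meas [MeasurableSpace E] (G : ℕ → E → ℝ) (M : ℕ → Kernel E E)
    [∀ k, IsMarkovKernel (M k)] (hGmeas : ∀ k, Measurable (G k)) (f : E → ℝ) (hf : Measurable f)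
    (k : ℕ) : ∀ p, Measurable (Qiter G M p k f) := by
  induction k with
  | zero => intro p; exact hf
  | succ k ih =>
    intro p
    exact (hGmeas (p + 1)).mul ((ih (p + 1)).stronglyMeasurable.integral_kernel).measurable

theorem fk_aux_bdd [MeasurableSpace E] [Nonempty E] (G : ℕ → E → ℝ) (M : ℕ → Kernel E E)
    [∀ k, IsMarkovKernel (M k)] (hGpos : ∀ k x, 0 < G k x)
    (hGmeas : ∀ k, Measurable (G k)) (hGbdd : ∀ k, ∃ C, ∀ x, G k x ≤ C)
    (k : ℕ) : ∀ p, (∀ x, 0 < Qiter G M p k (fun _ => 1) x) ∧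
      (∀ x, 0 < ∫ y, Qiter G M p k (fun _ => 1) y ∂(M p x)) ∧
      ∃ H, ∀ x, Qiter G M p k (fun _ => 1) x ≤ H := by
  induction k with
  | zero => intro p; simp only [Qiter]; exact ⟨fun _ => one_pos, by simp, 1, fun _ => le_rfl⟩
  | succ k ih =>
    intro p
    obtain ⟨h1, h2, H, h3⟩ := ih (p + 1)
    obtain ⟨C, hC⟩ := hGbdd (p + 1)
    have x0 : E := Classical.arbitrary E
    have hC0 : 0 ≤ C := (hGpos (p + 1) x0).le.trans (hC x0)
    have hH0 : 0 ≤ H := (h1 x0).le.trans (h3 x0)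
    have hp : ∀ x, 0 < Qiter G M p (k + 1) (fun _ => 1) x := fun x =>
      mul_pos (hGpos (p + 1) x) (h2 x)
    have hbd : ∀ x, Qiter G M p (k + 1) (fun _ => 1) x ≤ C * H := fun x => by
      refine mul_le_mul (hC x) ?_ (h2 x).le hC0
      calc _ ≤ ∫ _, H ∂(M (p + 1) x) := by
            apply integral_mono_of_nonneg (Filter.Eventually.of_forall fun y => (h1 y).le)
              (integrable_const H) (Filter.Eventually.of_forall h3)
        _ = H := by simp
    refine ⟨hp, fun x => ?_, C * H, hbd⟩
    rw [integral_pos_iff_support_of_nonneg (fun y => (hp y).le)]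
    · have : Function.support (Qiter G M p (k + 1) (fun _ => 1)) = Set.univ := by
        ext y; simp [(hp y).ne']
      rw [this]; simp
    · exact Integrable.of_bound
        (fk_aux_meas G M hGmeas _ measurable_const (k + 1) p).aestronglyMeasurable (C * H)
        (Filter.Eventually.of_forall fun y => by
          rw [Real.norm_eq_abs, abs_of_pos (hp y)]; exact hbd y)

theorem fk_aux_bge [MeasurableSpace E] (K : Kernel E E) [IsMarkovKernel K] (x y : E) (A : Set E)
    (hA : MeasurableSet A) : |(K x A).toReal - (K y A).toReal| ≤ dobF (kernelSF K) := by
  unfold dobF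
  refine le_ciSup (f := fun q : E × E × {A : Set E // MeasurableSet A} =>
    |kernelSF K q.1 q.2.2.1 - kernelSF K q.2.1 q.2.2.1|) ⟨1, ?_⟩ (x, y, ⟨A, hA⟩)
  rintro _ ⟨q, rfl⟩
  have h1 : ∀ z B, 0 ≤ kernelSF K z B ∧ kernelSF K z B ≤ 1 := fun z B =>
    ⟨ENNReal.toReal_nonneg, measureReal_le_one (μ := K z)⟩
  have := h1 q.1 q.2.2.1
  have := h1 q.2.1 q.2.2.1
  simp only [abs_le]
  constructor <;> linarith

theorem fk_aux_main [MeasurableSpace E] [Nonempty E]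
    (G : ℕ → E → ℝ) (M : ℕ → Kernel E E) [∀ k, IsMarkovKernel (M k)]
    (hGmeas : ∀ k, Measurable (G k))
    (hGpos : ∀ k x, 0 < G k x)
    (hGbdd : ∀ k, ∃ C, ∀ x, G k x ≤ C)
    (hgpnfin : ∀ p n, BddAbove (Set.range fun q : E × E => Gpn G M p n q.1 / Gpn G M p n q.2))
    (A : Set E) (hA : MeasurableSet A) (k : ℕ) : ∀ p x y,
    Qiter G M p k (A.indicator fun _ => 1) x / Qiter G M p k (fun _ => 1) x -
    Qiter G M p k (A.indicator fun _ => 1) y / Qiter G M p k (fun _ => 1) y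
      ≤ ∏ j ∈ Finset.Icc (p + 1) (p + k), blit M j * gpn G M j (p + k) := by
  induction k with
  | zero =>
    intro p x y
    have h0 : ∀ z, 0 ≤ A.indicator (fun _ => (1 : ℝ)) z ∧ A.indicator (fun _ => (1 : ℝ)) z ≤ 1 :=
      fun z => by by_cases hz : z ∈ A <;> simp [hz]
    simp only [Qiter]
    simp
    linarith [(h0 x).2, (h0 y).1]
  | succ k ih =>
    intro p x y
    have hprod : ∏ j ∈ Finset.Icc (p + 1) (p + (k + 1)), blit M j * gpn G M j (p + (k + 1)) =
        blit M (p + 1) * gpn G M (p + 1) (p + 1 + k) *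
        ∏ j ∈ Finset.Icc (p + 1 + 1) (p + 1 + k), blit M j * gpn G M j (p + 1 + k) := by
      rw [show p + (k + 1) = p + 1 + k by ring, ← Finset.insert_Icc_add_one_left_eq_Icc (by omega),
        Finset.prod_insert (by simp)]
    rw [hprod]
    obtain ⟨hpos, -, H, hH⟩ := fk_aux_bdd G M hGpos hGmeas hGbdd k (p + 1)
    have hint : ∀ z, 0 < ∫ w, Qiter G M (p + 1) k (fun _ => 1) w ∂(M (p + 1) z) := fun z =>
      pos_of_mul_pos_right ((fk_aux_bdd G M hGpos hGmeas hGbdd (k + 1) p).1 z) (hGpos _ z).le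
    have hGeq : Gpn G M (p + 1) (p + 1 + k) = Qiter G M (p + 1) k (fun _ => 1) := by
      simp [Gpn, Qpn]
    have hg : ∀ x y, Qiter G M (p + 1) k (fun _ => 1) x ≤
        gpn G M (p + 1) (p + 1 + k) * Qiter G M (p + 1) k (fun _ => 1) y := by
      intro x y
      rw [← div_le_iff₀ (hpos y), ← hGeq]
      exact le_ciSup (hgpnfin (p + 1) (p + 1 + k)) (x, y)
    have key := fk_aux_step2 (M (p + 1) x) (M (p + 1) y) (blit M (p + 1))
      (gpn G M (p + 1) (p + 1 + k)) _ H
      ((abs_nonneg _).trans (fk_aux_bge (M (p + 1)) x y A hA))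
      (by have := ih (p + 1) x x; rwa [sub_self] at this)
      (fun B hB => fk_aux_bge (M (p + 1)) x y B hB)
      (Qiter G M (p + 1) k (fun _ => 1))
      (fun z => Qiter G M (p + 1) k (A.indicator fun _ => 1) z /
        Qiter G M (p + 1) k (fun _ => 1) z)
      (fk_aux_meas G M hGmeas _ measurable_const k (p + 1))
      ((fk_aux_meas G M hGmeas _ (measurable_const.indicator hA) k (p + 1)).div
        (fk_aux_meas G M hGmeas _ measurable_const k (p + 1)))
      hpos hH hg (ih (p + 1)) (hint x) (hint y)
    have e : ∀ z, Qiter G M (p + 1) k (fun _ => 1) z *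
        (Qiter G M (p + 1) k (A.indicator fun _ => 1) z /
          Qiter G M (p + 1) k (fun _ => 1) z) = Qiter G M (p + 1) k (A.indicator fun _ => 1) z :=
      fun z => mul_div_cancel₀ _ (hpos z).ne'
    simp only [e] at key
    simp only [Qiter, Qop]
    rw [mul_div_mul_left _ _ (hGpos _ x).ne', mul_div_mul_left _ _ (hGpos _ y).ne']
    exact key

/-- For bounded measurable positive potential functions `(G_p)` and Markov
kernels `(M_p)`, with `b_k`, `g_{k,n}`, `b_{p,n}` the associated Feynman-Kac quantities
(all `g_{k,n}` assumed finite), one has for all `p ≤ n`: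
`b_{p,n} ≤ Π_{k=p+1}^{n} b_k · g_{k,n}`. -/
theorem fk_bpn_prod_bound [MeasurableSpace E] [Nonempty E]
    (G : ℕ → E → ℝ) (M : ℕ → Kernel E E) [∀ k, IsMarkovKernel (M k)]
    (hGmeas : ∀ k, Measurable (G k))
    (hGpos : ∀ k x, 0 < G k x)
    (hGbdd : ∀ k, ∃ C, ∀ x, G k x ≤ C)
    (hgpnfin : ∀ p n, BddAbove (Set.range fun q : E × E => Gpn G M p n q.1 / Gpn G M p n q.2))
    (p n : ℕ) (hpn : p ≤ n) :
    bpn G M p n ≤ ∏ k ∈ Finset.Icc (p + 1) n, blit M k * gpn G M k n := by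
  have : Nonempty {A : Set E // MeasurableSet A} := ⟨⟨∅, MeasurableSet.empty⟩⟩
  obtain ⟨k, rfl⟩ := Nat.exists_eq_add_of_le hpn
  refine ciSup_le fun q => ?_
  obtain ⟨x, y, A, hA⟩ := q
  have h := fk_aux_main G M hGmeas hGpos hGbdd hgpnfin A hA k p
  simp only [Ppn, Gpn, Qpn, Nat.add_sub_cancel_left]
  rw [abs_le]
  constructor
  · linarith [h y x]
  · exact h x y
end

section
/- Let (G_p) be bounded measurable positive potential functions and (M_p) Markov kernels on a measurable space E, with associated Feynman-Kac quantities g_p, b_p, g_{p,n} as defined below. Then the quantities g_{p,n} satisfy the backward inequalities g_{n,n} = 1 and g_{p−1,n} ≤ g_p · (1 + b_p · (g_{p,n} − 1)) for all 1 ≤ p ≤ n. -/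
open MeasureTheory ProbabilityTheory

variable {E : Type*}

theorem aux_diff [MeasurableSpace E] (μ ν : Measure E) [IsProbabilityMeasure μ]
    [IsProbabilityMeasure ν] (b a c : ℝ) (f : E → ℝ) (hf : Measurable f)
    (ha : ∀ x, a ≤ f x) (hc : ∀ x, f x ≤ c) (hac : a ≤ c)
    (hb : ∀ A, MeasurableSet A → μ.real A - ν.real A ≤ b) :
    ∫ x, f x ∂μ - ∫ x, f x ∂ν ≤ b * (c - a) := by
  have hint : ∀ (ρ : Measure E) [IsProbabilityMeasure ρ], Integrable f ρ := by
    intro ρ _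
    refine Integrable.of_bound hf.aestronglyMeasurable (max |a| |c|) (.of_forall fun x => ?_)
    exact abs_le_max_abs_abs (ha x) (hc x)
  have key : ∀ (ρ : Measure E) [IsProbabilityMeasure ρ],
      ∫ x, f x ∂ρ = a + ∫ t in (0:ℝ)..(c - a), ρ.real {x | t ≤ f x - a} := by
    intro ρ _
    have h1 : Integrable (fun x => f x - a) ρ := (hint ρ).sub (integrable_const a)
    have h2 := h1.integral_eq_integral_Ioc_meas_le (M := c - a)
      (.of_forall fun x => by simpa using ha x) (.of_forall fun x => by simpa using hc x)
    rw [integral_sub (hint ρ) (integrable_const a)] at h2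
    rw [intervalIntegral.integral_of_le (by linarith)]
    simp at h2
    linarith
  have hii : ∀ (ρ : Measure E) [IsProbabilityMeasure ρ],
      IntervalIntegrable (fun t => ρ.real {x | t ≤ f x - a}) volume 0 (c - a) := by
    intro ρ _
    apply Antitone.intervalIntegrable
    intro s t hst
    exact measureReal_mono (fun x hx => le_trans hst hx)
  rw [key μ, key ν, add_sub_add_left_eq_sub, ← intervalIntegral.integral_sub (hii μ) (hii ν)]
  have := intervalIntegral.integral_mono_on (a := 0) (b := c - a) (by linarith)
    ((hii μ).sub (hii ν)) (g := fun _ => b) (by simp)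
    (fun t _ => hb {x | t ≤ f x - a} (measurableSet_le measurable_const (hf.sub_const a)))
  refine this.trans (le_of_eq ?_)
  simp [mul_comm]

theorem aux_int_bounds [MeasurableSpace E] (μ : Measure E) [IsProbabilityMeasure μ]
    (a c : ℝ) (f : E → ℝ) (hf : Measurable f)
    (ha : ∀ x, a ≤ f x) (hc : ∀ x, f x ≤ c) :
    a ≤ ∫ x, f x ∂μ ∧ ∫ x, f x ∂μ ≤ c := by
  have hint : Integrable f μ := by
    refine Integrable.of_bound hf.aestronglyMeasurable (max |a| |c|) (.of_forall fun x => ?_)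
    exact abs_le_max_abs_abs (ha x) (hc x)
  constructor
  · simpa using integral_mono (integrable_const a) hint ha
  · simpa using integral_mono hint (integrable_const c) hc

theorem aux_iter [MeasurableSpace E] [Nonempty E]
    (G : ℕ → E → ℝ) (M : ℕ → Kernel E E) [∀ k, IsMarkovKernel (M k)]
    (hGmeas : ∀ k, Measurable (G k))
    (hGpos : ∀ k x, 0 < G k x)
    (hGbdd : ∀ k, ∃ C, ∀ x, G k x ≤ C)
    (hgfin : ∀ k, BddAbove (Set.range fun q : E × E => G k q.1 / G k q.2))
    (k p : ℕ) : Measurable (Qiter G M p k fun _ => 1) ∧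
      ∃ a c : ℝ, 0 < a ∧ ∀ x, a ≤ Qiter G M p k (fun _ => 1) x ∧
        Qiter G M p k (fun _ => 1) x ≤ c := by
  induction k generalizing p with
  | zero => exact ⟨measurable_const, 1, 1, one_pos, fun x => ⟨le_rfl, le_rfl⟩⟩
  | succ k ih =>
    obtain ⟨hm, a, c, ha, h⟩ := ih (p + 1)
    obtain ⟨C, hC⟩ := hGbdd (p + 1)
    obtain ⟨D, hD⟩ := hgfin (p + 1)
    have x0 : E := Classical.arbitrary E
    have hD' : ∀ x y, G (p+1) x / G (p+1) y ≤ D := fun x y => hD ⟨(x, y), rfl⟩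
    have hDpos : 0 < D := lt_of_lt_of_le (div_pos (hGpos _ x0) (hGpos _ x0)) (hD' x0 x0)
    have hb := fun x => aux_int_bounds (M (p+1) x) a c _ hm (fun y => (h y).1) (fun y => (h y).2)
    refine ⟨?_, G (p+1) x0 / D * a, C * c, mul_pos (div_pos (hGpos _ _) hDpos) ha, fun x => ⟨?_, ?_⟩⟩
    · exact (hGmeas (p+1)).mul
        (StronglyMeasurable.integral_kernel hm.stronglyMeasurable).measurable
    · refine mul_le_mul ?_ (hb x).1 ha.le (hGpos _ _).le
      rw [div_le_iff₀ hDpos, mul_comm, ← div_le_iff₀ (hGpos _ _)]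
      exact hD' x0 x
    · exact mul_le_mul (hC x) (hb x).2 (ha.le.trans (hb x).1) ((hGpos _ x).le.trans (hC x))

/-- For bounded measurable positive potential functions `(G_p)` and Markov
kernels `(M_p)`, the quantities `g_{p,n}` satisfy the backward inequalities
`g_{n,n} = 1` and `g_{p−1,n} ≤ g_p · (1 + b_p · (g_{p,n} − 1))` for all `1 ≤ p ≤ n`. -/
theorem fk_gpn_backward [MeasurableSpace E] [Nonempty E]
    (G : ℕ → E → ℝ) (M : ℕ → Kernel E E) [∀ k, IsMarkovKernel (M k)]
    (hGmeas : ∀ k, Measurable (G k))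
    (hGpos : ∀ k x, 0 < G k x)
    (hGbdd : ∀ k, ∃ C, ∀ x, G k x ≤ C)
    (hgfin : ∀ k, BddAbove (Set.range fun q : E × E => G k q.1 / G k q.2))
    (n : ℕ) :
    gpn G M n n = 1 ∧
      ∀ p, 1 ≤ p → p ≤ n →
        gpn G M (p - 1) n ≤ glit G p * (1 + blit M p * (gpn G M p n - 1)) := by
  constructor
  · simp [gpn, ratioSup, Gpn, Qpn, Qiter]
  · intro p hp hpn
    obtain ⟨q, rfl⟩ : ∃ q, p = q + 1 := ⟨p - 1, by omega⟩
    obtain ⟨k, rfl⟩ : ∃ k, n = q + 1 + k := ⟨n - (q + 1), by omega⟩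
    obtain ⟨hm, a, c, ha, h⟩ := aux_iter G M hGmeas hGpos hGbdd hgfin k (q + 1)
    have e1 : Gpn G M (q + 1 - 1) (q + 1 + k)
        = Qop G M (q + 1) (Qiter G M (q + 1) k fun _ => 1) := by
      have : q + 1 + k - q = k + 1 := by omega
      simp [Gpn, Qpn, this, Qiter]
    have e2 : Gpn G M (q + 1) (q + 1 + k) = Qiter G M (q + 1) k fun _ => 1 := by
      simp [Gpn, Qpn]
    unfold gpn glit
    rw [e1, e2]
    generalize Qiter G M (q + 1) k (fun _ => 1) = f at hm h
    have hfpos : ∀ x, 0 < f x := fun x => ha.trans_le (h x).1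
    have hbdd : BddAbove (Set.range fun q : E × E => f q.1 / f q.2) := by
      refine ⟨c / a, ?_⟩
      rintro _ ⟨⟨x, y⟩, rfl⟩
      exact div_le_div₀ ((hfpos x).le.trans (h x).2) (h x).2 ha (h y).1
    have hr : ∀ x y, f x ≤ ratioSup f * f y := fun x y => by
      rw [← div_le_iff₀ (hfpos y)]
      exact le_ciSup hbdd (x, y)
    have x0 : E := Classical.arbitrary E
    have hr1 : 1 ≤ ratioSup f := by
      have := hr x0 x0
      have := hfpos x0
      by_contra hh
      nlinarith
    have hGr : ∀ x y, G (q+1) x / G (q+1) y ≤ ratioSup (G (q+1)) := fun x y =>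
      le_ciSup (hgfin (q+1)) (x, y)
    have hbb : BddAbove (Set.range fun r : E × E × {A : Set E // MeasurableSet A} =>
        |kernelSF (M (q+1)) r.1 r.2.2.1 - kernelSF (M (q+1)) r.2.1 r.2.2.1|) := by
      refine ⟨1, ?_⟩
      rintro _ ⟨⟨x, y, A⟩, rfl⟩
      have h1 : kernelSF (M (q+1)) x A.1 ≤ 1 := measureReal_le_one
      have h2 : kernelSF (M (q+1)) y A.1 ≤ 1 := measureReal_le_one
      have h3 : 0 ≤ kernelSF (M (q+1)) x A.1 := measureReal_nonneg
      have h4 : 0 ≤ kernelSF (M (q+1)) y A.1 := measureReal_nonneg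
      exact abs_le.2 ⟨by simp only; linarith, by simp only; linarith⟩
    have hb : ∀ x y A, MeasurableSet A →
        (M (q+1) x).real A - (M (q+1) y).real A ≤ blit M (q+1) := fun x y A hA =>
      (le_abs_self _).trans (le_ciSup hbb (x, y, ⟨A, hA⟩))
    have hb0 : 0 ≤ blit M (q+1) := by
      simpa using hb x0 x0 ∅ MeasurableSet.empty
    obtain ⟨m, hmdef⟩ : ∃ m, m = ⨅ y, f y := ⟨_, rfl⟩
    have hmle : ∀ y, m ≤ f y := fun y => hmdef ▸ ciInf_le ⟨a, by rintro _ ⟨x, rfl⟩; exact (h x).1⟩ y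
    have hrm : ∀ x, f x ≤ ratioSup f * m := fun x => by
      rw [← div_le_iff₀' (by linarith), hmdef]
      exact le_ciInf fun y => by
        rw [div_le_iff₀' (by linarith)]; exact hr x y
    refine ciSup_le ?_
    rintro ⟨x, y⟩
    have hd := aux_diff (M (q+1) x) (M (q+1) y) (blit M (q+1)) m (ratioSup f * m) f hm hmle hrm
      ((hmle x0).trans (hrm x0)) (hb x y)
    have hy := (aux_int_bounds (M (q+1) y) m c f hm hmle (fun y => (h y).2)).1
    have hya := (aux_int_bounds (M (q+1) y) a c f hm (fun y => (h y).1) (fun y => (h y).2)).1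
    have hxa := (aux_int_bounds (M (q+1) x) a c f hm (fun y => (h y).1) (fun y => (h y).2)).1
    simp only [Qop]
    rw [mul_div_mul_comm]
    have hgp := div_pos (hGpos (q+1) x) (hGpos (q+1) y)
    refine mul_le_mul (hGr x y) ?_ (div_nonneg (by linarith) (by linarith)) (hgp.le.trans (hGr x y))
    rw [div_le_iff₀ (by linarith)]
    have := mul_le_mul_of_nonneg_left hy (mul_nonneg hb0 (sub_nonneg.2 hr1))
    nlinarith
end

section
/- Let (G_p) be bounded measurable positive potential functions and (M_p) Markov kernels on a measurable space E, with associated Feynman-Kac quantities b_k, g_{p,n}, b_{p,n} as defined below. Then for all integers p ≤ n, g_{p,n} · b_{p,n} ≤ Π_{k=p+1}^{n} b_k · g_{k−1,n}. -/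
open MeasureTheory ProbabilityTheory

variable {E : Type*}

section FKHelpers

theorem fk_diff_le [MeasurableSpace E] (μ ν : Measure E) [IsProbabilityMeasure μ]
    [IsProbabilityMeasure ν] (b l L : ℝ)
    (hb : ∀ A, MeasurableSet A → |μ.real A - ν.real A| ≤ b)
    (φ : E → ℝ) (hφ : Measurable φ) (hl : ∀ x, l ≤ φ x) (hu : ∀ x, φ x ≤ l + L) (hL : 0 ≤ L) :
    |∫ x, φ x ∂μ - ∫ x, φ x ∂ν| ≤ b * L := by
  have key : ∀ (ρ : Measure E) [IsProbabilityMeasure ρ], Integrable φ ρ ∧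
      (∫ x, φ x ∂ρ) = l + ∫ t in Set.Ioc 0 L, ρ.real {a | t ≤ φ a - l} := by
    intro ρ _
    have hi : Integrable φ ρ := by
      refine Integrable.of_bound hφ.aestronglyMeasurable (|l| + L) (ae_of_all _ fun x => ?_)
      rw [Real.norm_eq_abs, abs_le]
      have := hl x
      have := hu x
      have := le_abs_self l
      have := neg_abs_le l
      constructor <;> linarith
    refine ⟨hi, ?_⟩
    have h1 : Integrable (fun x => φ x - l) ρ := hi.sub (integrable_const l)
    have h2 := h1.integral_eq_integral_Ioc_meas_le (M := L)
      (ae_of_all _ fun x => by simpa using hl x)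
      (ae_of_all _ fun x => by have := hu x; simp only; linarith)
    rw [← h2, integral_sub hi (integrable_const l)]
    simp
  have hint : ∀ (ρ : Measure E) [IsProbabilityMeasure ρ],
      IntegrableOn (fun t : ℝ => ρ.real {a | t ≤ φ a - l}) (Set.Ioc 0 L) := by
    intro ρ _
    have hanti : Antitone (fun t : ℝ => ρ.real {a | t ≤ φ a - l}) := by
      intro s t hst
      exact measureReal_mono (fun a ha => le_trans hst ha)
    refine Measure.integrableOn_of_bounded (M := 1) (by simp) hanti.measurable.aestronglyMeasurable
      (ae_of_all _ fun t => ?_)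
    rw [Real.norm_eq_abs, abs_of_nonneg measureReal_nonneg]
    exact measureReal_le_one
  rw [(key μ).2, (key ν).2, add_sub_add_left_eq_sub, ← integral_sub (hint μ) (hint ν)]
  have := norm_setIntegral_le_of_norm_le_const (μ := volume) (s := Set.Ioc (0:ℝ) L) (C := b)
    (f := fun t : ℝ => μ.real {a | t ≤ φ a - l} - ν.real {a | t ≤ φ a - l}) (by simp)
    (fun t _ => hb _ (measurableSet_le measurable_const (hφ.sub_const l)))
  simpa [hL] using this

theorem fk_step [MeasurableSpace E] (μ ν : Measure E) [IsProbabilityMeasure μ]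
    [IsProbabilityMeasure ν] (b g B : ℝ) [Nonempty E]
    (hb : ∀ A, MeasurableSet A → |μ.real A - ν.real A| ≤ b)
    (h F : E → ℝ) (hh : Measurable h) (hF : Measurable F) (hpos : ∀ x, 0 < h x)
    (hF0 : ∀ x, 0 ≤ F x) (hF1 : ∀ x, F x ≤ h x)
    (hg : ∀ x y, h x / h y ≤ g) (hB : ∀ x y, |F x / h x - F y / h y| ≤ B) :
    |(∫ x, F x ∂μ) / (∫ x, h x ∂μ) - (∫ x, F x ∂ν) / (∫ x, h x ∂ν)| ≤ b * g * B := by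
  obtain ⟨x0⟩ := ‹Nonempty E›
  have hgm : ∀ x y, h x ≤ g * h y := fun x y => (div_le_iff₀ (hpos y)).1 (hg x y)
  have hhb : BddAbove (Set.range h) := ⟨g * h x0, by rintro _ ⟨x, rfl⟩; exact hgm x x0⟩
  set H := ⨆ x, h x with hH
  have hxH : ∀ x, h x ≤ H := fun x => le_ciSup hhb x
  have hHg : ∀ y, H ≤ g * h y := fun y => by
    haveI : Nonempty E := ⟨x0⟩
    exact ciSup_le fun x => hgm x y
  have hH0 : 0 < H := (hpos x0).trans_le (hxH x0)
  set f := fun x => F x / h x with hf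
  have hfb : BddAbove (Set.range f) := ⟨1, by
    rintro _ ⟨x, rfl⟩; exact (div_le_one (hpos x)).2 (hF1 x)⟩
  set S := ⨆ x, f x with hS
  have hfS : ∀ x, f x ≤ S := fun x => le_ciSup hfb x
  have hSf : ∀ y, S ≤ f y + B := fun y => by
    haveI : Nonempty E := ⟨x0⟩
    refine ciSup_le fun x => ?_
    have := (abs_le.1 (hB x y)).2
    simp only [hf]; linarith
  have hFf : ∀ x, F x = f x * h x := fun x => by
    simp only [hf]; rw [div_mul_cancel₀ _ (hpos x).ne']
  have ih : ∀ (ρ : Measure E) [IsProbabilityMeasure ρ], Integrable h ρ := fun ρ _ =>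
    Integrable.of_bound hh.aestronglyMeasurable H (ae_of_all _ fun x => by
      rw [Real.norm_eq_abs, abs_of_pos (hpos x)]; exact hxH x)
  have iF : ∀ (ρ : Measure E) [IsProbabilityMeasure ρ], Integrable F ρ := fun ρ _ =>
    (ih ρ).mono' hF.aestronglyMeasurable (ae_of_all _ fun x => by
      rw [Real.norm_eq_abs, abs_of_nonneg (hF0 x)]; exact hF1 x)
  have hg0 : 0 < g := by
    have := hg x0 x0
    rw [div_self (hpos x0).ne'] at this; linarith
  have hHI : ∀ (ρ : Measure E) [IsProbabilityMeasure ρ], H ≤ g * ∫ x, h x ∂ρ := fun ρ _ => by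
    rw [← integral_const_mul]
    calc H = ∫ _, H ∂ρ := by simp
      _ ≤ _ := integral_mono (integrable_const _) ((ih ρ).const_mul g) hHg
  have hIpos : ∀ (ρ : Measure E) [IsProbabilityMeasure ρ], 0 < ∫ x, h x ∂ρ := fun ρ _ => by
    have := hHI ρ
    exact pos_of_mul_pos_right (hH0.trans_le this) hg0.le
  set c := (∫ x, F x ∂ν) / (∫ x, h x ∂ν) with hc
  have hcS : c ≤ S := by
    rw [hc, div_le_iff₀ (hIpos ν), ← integral_const_mul]
    refine integral_mono (iF ν) ((ih ν).const_mul _) fun x => ?_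
    simp only [hFf x]
    exact mul_le_mul_of_nonneg_right (hfS x) (hpos x).le
  have hcB : S - B ≤ c := by
    rw [hc, le_div_iff₀ (hIpos ν), ← integral_const_mul]
    refine integral_mono ((ih ν).const_mul _) (iF ν) fun x => ?_
    simp only [hFf x]
    exact mul_le_mul_of_nonneg_right (by linarith [hSf x]) (hpos x).le
  have hB0 : 0 ≤ B := (abs_nonneg _).trans (hB x0 x0)
  have hb0 : 0 ≤ b := (abs_nonneg _).trans (hb ∅ MeasurableSet.empty)
  have hcν : (∫ x, F x - c * h x ∂ν) = 0 := by
    rw [integral_sub (iF ν) ((ih ν).const_mul c), integral_const_mul, hc,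
      div_mul_cancel₀ _ (hIpos ν).ne', sub_self]
  have main := fk_diff_le μ ν b (-(H * (c - S + B))) (H * B) hb (fun x => F x - c * h x)
    (hF.sub (hh.const_mul c))
    (fun x => by
      simp only [hFf x]
      nlinarith [hSf x, hxH x, hpos x, mul_nonneg (hpos x).le (sub_nonneg.2 (hSf x)),
        mul_nonneg (sub_nonneg.2 (hxH x)) (sub_nonneg.2 hcB)])
    (fun x => by
      simp only [hFf x]
      nlinarith [hSf x, hxH x, hpos x, mul_nonneg (hpos x).le (sub_nonneg.2 (hfS x)),
        mul_nonneg (sub_nonneg.2 (hxH x)) (sub_nonneg.2 hcS)])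
    (by positivity)
  rw [hcν, sub_zero, integral_sub (iF μ) ((ih μ).const_mul c), integral_const_mul] at main
  have e : (∫ x, F x ∂μ) / (∫ x, h x ∂μ) - c
      = ((∫ x, F x ∂μ) - c * ∫ x, h x ∂μ) / (∫ x, h x ∂μ) := by
    have := (hIpos μ).ne'
    field_simp
  rw [e, abs_div, abs_of_pos (hIpos μ), div_le_iff₀ (hIpos μ)]
  refine main.trans ?_
  have := mul_le_mul_of_nonneg_left (hHI μ) (mul_nonneg hb0 hB0)
  linarith

theorem fk_qiter [MeasurableSpace E] [Nonempty E]
    (G : ℕ → E → ℝ) (M : ℕ → Kernel E E) [∀ k, IsMarkovKernel (M k)]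
    (hGmeas : ∀ k, Measurable (G k))
    (hGpos : ∀ k x, 0 < G k x)
    (hGbdd : ∀ k, ∃ C, ∀ x, G k x ≤ C) (F : E → ℝ) (hF : Measurable F)
    (hF0 : ∀ x, 0 ≤ F x) (hF1 : ∀ x, F x ≤ 1) (k : ℕ) : ∀ p : ℕ,
    Measurable (Qiter G M p k (fun _ => 1)) ∧ Measurable (Qiter G M p k F) ∧
    (∀ x, 0 < Qiter G M p k (fun _ => 1) x) ∧ (∃ C, ∀ x, Qiter G M p k (fun _ => 1) x ≤ C) ∧
    (∀ x, 0 ≤ Qiter G M p k F x) ∧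
    (∀ x, Qiter G M p k F x ≤ Qiter G M p k (fun _ => 1) x) := by
  induction k with
  | zero =>
    intro p
    simp only [Qiter]
    exact ⟨measurable_const, hF, fun _ => one_pos, ⟨1, fun _ => le_rfl⟩, hF0, hF1⟩
  | succ k ih =>
    intro p
    obtain ⟨m1, mF, pos, ⟨C, hC⟩, F0, F1⟩ := ih (p + 1)
    obtain ⟨D, hD⟩ := hGbdd (p + 1)
    have i1 : ∀ x, Integrable (Qiter G M (p + 1) k (fun _ => 1)) (M (p + 1) x) := fun x =>
      Integrable.of_bound m1.aestronglyMeasurable C (ae_of_all _ fun y => by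
        rw [Real.norm_eq_abs, abs_of_pos (pos y)]; exact hC y)
    have iF : ∀ x, Integrable (Qiter G M (p + 1) k F) (M (p + 1) x) := fun x =>
      (i1 x).mono' mF.aestronglyMeasurable (ae_of_all _ fun y => by
        rw [Real.norm_eq_abs, abs_of_nonneg (F0 y)]; exact F1 y)
    simp only [Qiter, Qop]
    refine ⟨(hGmeas _).mul (m1.stronglyMeasurable.integral_kernel).measurable,
      (hGmeas _).mul (mF.stronglyMeasurable.integral_kernel).measurable, fun x => ?_,
      ⟨D * C, fun x => ?_⟩, fun x => ?_, fun x => ?_⟩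
    · refine mul_pos (hGpos _ x) ?_
      rw [integral_pos_iff_support_of_nonneg (fun y => (pos y).le) (i1 x)]
      have : Function.support (Qiter G M (p + 1) k (fun _ => 1)) = Set.univ := by
        ext y; simp [(pos y).ne']
      rw [this]; simp
    · have h0 : 0 ≤ ∫ y, Qiter G M (p + 1) k (fun _ => 1) y ∂(M (p + 1) x) :=
        integral_nonneg fun y => (pos y).le
      refine mul_le_mul (hD x) ?_ h0 ((hGpos _ x).le.trans (hD x))
      calc _ ≤ ∫ _, C ∂(M (p + 1) x) := integral_mono (i1 x) (integrable_const _) hC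
        _ = C := by simp
    · exact mul_nonneg (hGpos _ x).le (integral_nonneg F0)
    · exact mul_le_mul_of_nonneg_left (integral_mono (iF x) (i1 x) F1) (hGpos _ x).le

end FKHelpers

/-- For bounded measurable positive potential functions `(G_p)` and Markov
kernels `(M_p)`, with `b_k`, `g_{p,n}`, `b_{p,n}` the associated Feynman-Kac quantities
(all `g_{p,n}` assumed finite), one has for all `p ≤ n`:
`g_{p,n} · b_{p,n} ≤ Π_{k=p+1}^{n} b_k · g_{k−1,n}`. -/
theorem fk_gpn_bpn_prod_bound [MeasurableSpace E] [Nonempty E]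
    (G : ℕ → E → ℝ) (M : ℕ → Kernel E E) [∀ k, IsMarkovKernel (M k)]
    (hGmeas : ∀ k, Measurable (G k))
    (hGpos : ∀ k x, 0 < G k x)
    (hGbdd : ∀ k, ∃ C, ∀ x, G k x ≤ C)
    (hgpnfin : ∀ p n, BddAbove (Set.range fun q : E × E => Gpn G M p n q.1 / Gpn G M p n q.2))
    (p n : ℕ) (hpn : p ≤ n) :
    gpn G M p n * bpn G M p n ≤ ∏ k ∈ Finset.Icc (p + 1) n, blit M k * gpn G M (k - 1) n := by
  have hq := fun (A : Set E) (hA : MeasurableSet A) => fk_qiter G M hGmeas hGpos hGbdd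
    (A.indicator fun _ => 1) (measurable_const.indicator hA)
    (fun x => Set.indicator_nonneg (fun _ _ => zero_le_one) x)
    (fun x => Set.indicator_le_self' (f := fun _ : E => (1 : ℝ)) (fun _ _ => zero_le_one) x)
  have hPbd : ∀ p n x y (A : Set E), MeasurableSet A →
      |Ppn G M p n x A - Ppn G M p n y A| ≤ 1 := by
    intro p n x y A hA
    obtain ⟨_, _, pos, _, F0, F1⟩ := hq A hA (n - p) p
    have h : ∀ x, 0 ≤ Ppn G M p n x A ∧ Ppn G M p n x A ≤ 1 := fun x =>
      ⟨div_nonneg (F0 x) (pos x).le, (div_le_one (pos x)).2 (F1 x)⟩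
    rw [abs_le]
    constructor <;> linarith [(h x).1, (h x).2, (h y).1, (h y).2]
  have hPle : ∀ p n x y (A : Set E), MeasurableSet A →
      |Ppn G M p n x A - Ppn G M p n y A| ≤ bpn G M p n := by
    intro p n x y A hA
    exact le_ciSup (f := fun q : E × E × {A : Set E // MeasurableSet A} =>
      |Ppn G M p n q.1 q.2.2.1 - Ppn G M p n q.2.1 q.2.2.1|)
      ⟨1, by rintro _ ⟨q, rfl⟩; exact hPbd p n _ _ _ q.2.2.2⟩ (x, y, ⟨A, hA⟩)
  haveI : Nonempty {A : Set E // MeasurableSet A} := ⟨⟨∅, MeasurableSet.empty⟩⟩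
  have hMle : ∀ k x y (A : Set E), MeasurableSet A →
      |(M k x).real A - (M k y).real A| ≤ blit M k := by
    intro k x y A hA
    refine le_ciSup (f := fun q : E × E × {A : Set E // MeasurableSet A} =>
      |kernelSF (M k) q.1 q.2.2.1 - kernelSF (M k) q.2.1 q.2.2.1|)
      ⟨1, ?_⟩ (x, y, ⟨A, hA⟩)
    rintro _ ⟨q, rfl⟩
    have h : ∀ x (A : Set E), 0 ≤ kernelSF (M k) x A ∧ kernelSF (M k) x A ≤ 1 := fun x A =>
      ⟨measureReal_nonneg, measureReal_le_one⟩
    simp only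
    rw [abs_le]
    constructor <;> linarith [(h q.1 q.2.2.1).1, (h q.1 q.2.2.1).2, (h q.2.1 q.2.2.1).1,
      (h q.2.1 q.2.2.1).2]
  have hgle : ∀ p n x y, Gpn G M p n x / Gpn G M p n y ≤ gpn G M p n := fun p n x y =>
    le_ciSup (hgpnfin p n) (x, y)
  have hGp : ∀ p n x, 0 < Gpn G M p n x := fun p n x =>
    (hq ∅ MeasurableSet.empty (n - p) p).2.2.1 x
  obtain ⟨x0⟩ := id ‹Nonempty E›
  have hg0 : ∀ p n, 0 ≤ gpn G M p n := fun p n =>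
    (div_pos (hGp p n x0) (hGp p n x0)).le.trans (hgle p n x0 x0)
  have hb0 : ∀ k, 0 ≤ blit M k := fun k =>
    (abs_nonneg _).trans (hMle k x0 x0 ∅ MeasurableSet.empty)
  have hrec : ∀ p n, p < n →
      bpn G M p n ≤ blit M (p + 1) * gpn G M (p + 1) n * bpn G M (p + 1) n := by
    intro p n hlt
    refine ciSup_le fun q => ?_
    obtain ⟨x, y, A, hA⟩ := q
    obtain ⟨m1, mF, pos, _, F0, F1⟩ := hq A hA (n - (p + 1)) (p + 1)
    have := fk_step (M (p + 1) x) (M (p + 1) y) (blit M (p + 1)) (gpn G M (p + 1) n)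
      (bpn G M (p + 1) n) (hMle (p + 1) x y) _ _ m1 mF pos F0 F1 (hgle (p + 1) n)
      (fun x y => hPle (p + 1) n x y A hA)
    have e : n - p = (n - (p + 1)) + 1 := by omega
    simp only [Ppn, Gpn, Qpn, e, Qiter, Qop]
    rw [mul_div_mul_left _ _ (hGpos _ x).ne', mul_div_mul_left _ _ (hGpos _ y).ne']
    exact this
  obtain ⟨k, hk⟩ : ∃ k, k = n - p := ⟨_, rfl⟩
  induction k generalizing p with
  | zero =>
    have hpe : p = n := by omega
    subst hpe
    have h1 : gpn G M p p = 1 := by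
      simp [gpn, ratioSup, Gpn, Qpn, Qiter]
    have h2 : bpn G M p p ≤ 1 := ciSup_le fun q => hPbd p p _ _ _ q.2.2.2
    simpa [h1] using h2
  | succ k ih =>
    have hlt : p < n := by omega
    have h1 := ih (p + 1) hlt (by omega)
    rw [← Finset.insert_Icc_add_one_left_eq_Icc (show p + 1 ≤ n from hlt),
      Finset.prod_insert (by simp)]
    calc gpn G M p n * bpn G M p n
        ≤ gpn G M p n * (blit M (p + 1) * gpn G M (p + 1) n * bpn G M (p + 1) n) :=
          mul_le_mul_of_nonneg_left (hrec p n hlt) (hg0 p n)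
      _ = blit M (p + 1) * gpn G M p n * (gpn G M (p + 1) n * bpn G M (p + 1) n) := by ring
      _ ≤ _ := by
        simp only [Nat.add_sub_cancel]
        exact mul_le_mul_of_nonneg_left h1 (mul_nonneg (hb0 _) (hg0 p n))
end

section
/- Let (G_p) be bounded measurable positive potential functions and (M_p) Markov kernels on a measurable space E, with associated Feynman-Kac quantities g_p, b_p, g_{p,n}, b_{p,n} as defined below. Let a ∈ (0,1) and set α = a/(1−a). Assume the sequence (g_p) is decreasing with g_p > 1 for all p, and that for every p ≥ 1 one has b_p ≤ (g_p^α − 1)/(g_p^{α+1} − 1) and b_p ≤ a/g_p^{α+1}. Then for all integers p ≤ n: (i) g_{p,n} ≤ (g_{p+1})^{1+α}; (ii) g_{p−1,n} · b_p ≤ a; and consequently (iii) g_{p,n} · b_{p,n} ≤ a^{n−p}. -/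
open MeasureTheory ProbabilityTheory

variable {E : Type*}

theorem aux_bdd_integrable [MeasurableSpace E] (μ : Measure E) [IsProbabilityMeasure μ]
    (f : E → ℝ) (hf : Measurable f) (lo hi : ℝ) (h1 : ∀ x, lo ≤ f x) (h2 : ∀ x, f x ≤ hi) :
    Integrable f μ := by
  refine Integrable.of_bound hf.aestronglyMeasurable (max |lo| |hi|)
    (Filter.Eventually.of_forall fun x => ?_)
  exact abs_le_max_abs_abs (h1 x) (h2 x)

theorem aux_layer [MeasurableSpace E] (μ ν : Measure E) [IsProbabilityMeasure μ]
    [IsProbabilityMeasure ν] (b : ℝ)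
    (hb : ∀ A, MeasurableSet A → μ.real A - ν.real A ≤ b)
    (f : E → ℝ) (hf : Measurable f) (L : ℝ) (hL : 0 ≤ L) (h1 : ∀ x, 0 ≤ f x)
    (h2 : ∀ x, f x ≤ L) :
    ∫ x, f x ∂μ - ∫ x, f x ∂ν ≤ b * L := by
  have key : ∀ (ρ : Measure E) [IsProbabilityMeasure ρ],
      IntegrableOn (fun t : ℝ => ρ.real {a : E | t ≤ f a}) (Set.Ioc 0 L) := by
    intro ρ _
    have hm : Measurable (fun t : ℝ => ρ.real {a : E | t ≤ f a}) := by
      apply Antitone.measurable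
      intro s t hst
      exact measureReal_mono (fun a ha => le_trans hst ha)
    refine Integrable.of_bound hm.aestronglyMeasurable 1 (Filter.Eventually.of_forall fun x => ?_)
    rw [Real.norm_eq_abs, abs_of_nonneg measureReal_nonneg]
    exact measureReal_le_one
  rw [(aux_bdd_integrable μ f hf 0 L h1 h2).integral_eq_integral_Ioc_meas_le
      (Filter.Eventually.of_forall h1) (Filter.Eventually.of_forall h2),
    (aux_bdd_integrable ν f hf 0 L h1 h2).integral_eq_integral_Ioc_meas_le
      (Filter.Eventually.of_forall h1) (Filter.Eventually.of_forall h2),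
    ← integral_sub (key μ) (key ν)]
  have : ∫ t in Set.Ioc 0 L, (μ.real {a : E | t ≤ f a} - ν.real {a : E | t ≤ f a})
      ≤ ∫ t in Set.Ioc (0:ℝ) L, b := by
    apply integral_mono ((key μ).sub (key ν)) (integrable_const b)
    intro t
    exact hb _ (measurableSet_le measurable_const hf)
  refine this.trans (le_of_eq ?_)
  simp [hL, mul_comm]

theorem aux_dob_bdd [MeasurableSpace E] (P : E → Set E → ℝ)
    (h0 : ∀ x A, MeasurableSet A → 0 ≤ P x A) (h1 : ∀ x A, MeasurableSet A → P x A ≤ 1) :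
    (∀ x y A, MeasurableSet A → |P x A - P y A| ≤ dobF P) ∧ 0 ≤ dobF P := by
  refine ⟨?_, Real.iSup_nonneg fun _ => abs_nonneg _⟩
  intro x y A hA
  have hB : BddAbove (Set.range fun q : E × E × {A : Set E // MeasurableSet A} =>
      |P q.1 q.2.2.1 - P q.2.1 q.2.2.1|) := by
    refine ⟨1, ?_⟩
    rintro _ ⟨q, rfl⟩
    have a1 := h0 q.1 _ q.2.2.2
    have a2 := h1 q.1 _ q.2.2.2
    have a3 := h0 q.2.1 _ q.2.2.2
    have a4 := h1 q.2.1 _ q.2.2.2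
    exact abs_le.2 ⟨by linarith, by linarith⟩
  exact le_ciSup hB (x, y, ⟨A, hA⟩)

theorem aux_kernel_bdd [MeasurableSpace E] (K : Kernel E E) [IsMarkovKernel K] :
    (∀ x y A, MeasurableSet A → |(K x).real A - (K y).real A| ≤ dobF (kernelSF K)) ∧
      0 ≤ dobF (kernelSF K) :=
  aux_dob_bdd (kernelSF K) (fun _ _ _ => ENNReal.toReal_nonneg)
    (fun x A _ => (measureReal_le_one : (K x).real A ≤ 1))

theorem aux_osc [MeasurableSpace E] (K : Kernel E E) [IsMarkovKernel K]
    (f : E → ℝ) (hf : Measurable f) (lo hi : ℝ) (h1 : ∀ x, lo ≤ f x) (h2 : ∀ x, f x ≤ hi)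
    (x y : E) :
    ∫ z, f z ∂(K x) - ∫ z, f z ∂(K y) ≤ dobF (kernelSF K) * (hi - lo) := by
  have hint := fun x => aux_bdd_integrable (K x) f hf lo hi h1 h2
  have := aux_layer (K x) (K y) (dobF (kernelSF K))
    (fun A hA => (le_abs_self _).trans ((aux_kernel_bdd K).1 x y A hA))
    (fun z => f z - lo) (hf.sub_const lo) (hi - lo)
    (by linarith [h1 x, h2 x]) (fun z => by linarith [h1 z]) (fun z => by linarith [h2 z])
  rw [integral_sub (hint x) (integrable_const _), integral_sub (hint y) (integrable_const _)]
    at this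
  simpa using this

/-- one-step bound on the ratio -/
theorem aux_ratio [MeasurableSpace E] [Nonempty E] (K : Kernel E E) [IsMarkovKernel K]
    (h : E → ℝ) (hm : Measurable h) (hpos : ∀ x, 0 < h x) (r : ℝ)
    (hr : ∀ x y, h x ≤ r * h y) (x y : E) :
    ∫ z, h z ∂(K x) ≤ (1 + dobF (kernelSF K) * (r - 1)) * ∫ z, h z ∂(K y) := by
  obtain ⟨x0⟩ := ‹Nonempty E›
  have hr1 : 1 ≤ r := by
    have := hr x0 x0
    have := hpos x0
    by_contra hc
    push Not at hc
    nlinarith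
  have hB : BddBelow (Set.range h) := ⟨0, by rintro _ ⟨z, rfl⟩; exact (hpos z).le⟩
  have h1 : ∀ z, (⨅ w, h w) ≤ h z := fun z => ciInf_le hB z
  have h2 : ∀ z, h z ≤ r * ⨅ w, h w := by
    intro z
    haveI : Nonempty E := ⟨x0⟩
    have : h z / r ≤ ⨅ w, h w := le_ciInf fun w => by
      rw [div_le_iff₀ (by linarith)]; linarith [hr z w]
    rw [div_le_iff₀ (by linarith)] at this
    linarith
  have ho := aux_osc K h hm _ _ h1 h2 x y
  have hI : (⨅ w, h w) ≤ ∫ z, h z ∂(K y) := by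
    have := integral_mono (μ := K y) (integrable_const (⨅ w, h w))
      (aux_bdd_integrable (K y) h hm _ _ h1 h2) h1
    simpa using this
  have hb := (aux_kernel_bdd K).2
  have : dobF (kernelSF K) * (r - 1) * (⨅ w, h w) ≤
      dobF (kernelSF K) * (r - 1) * ∫ z, h z ∂(K y) :=
    mul_le_mul_of_nonneg_left hI (mul_nonneg hb (by linarith))
  nlinarith

/-- one-step contraction bound -/
theorem aux_contr [MeasurableSpace E] [Nonempty E] (K : Kernel E E) [IsMarkovKernel K]
    (h u : E → ℝ) (hm : Measurable h) (um : Measurable u) (hpos : ∀ x, 0 < h x)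
    (u0 : ∀ x, 0 ≤ u x) (u1 : ∀ x, u x ≤ h x) (r c : ℝ)
    (hr : ∀ x y, h x ≤ r * h y) (hc : ∀ x y, u x / h x - u y / h y ≤ c) (x y : E) :
    (∫ z, u z ∂(K x)) / (∫ z, h z ∂(K x)) - (∫ z, u z ∂(K y)) / (∫ z, h z ∂(K y)) ≤
      r * dobF (kernelSF K) * c := by
  obtain ⟨x0⟩ := id ‹Nonempty E›
  have hint : ∀ x, Integrable h (K x) := fun x =>
    aux_bdd_integrable (K x) h hm 0 (r * h x0) (fun z => (hpos z).le) (fun z => hr z x0)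
  have uint : ∀ x, Integrable u (K x) := fun x =>
    aux_bdd_integrable (K x) u um 0 (r * h x0) u0 (fun z => (u1 z).trans (hr z x0))
  have hIpos : ∀ x, 0 < ∫ z, h z ∂(K x) := by
    intro x
    rw [integral_pos_iff_support_of_nonneg (fun z => (hpos z).le) (hint x)]
    have : Function.support h = Set.univ := by
      ext z; simp [(hpos z).ne']
    rw [this]; simp
  set φ : E → ℝ := fun z => u z / h z with hφ
  have hB : BddBelow (Set.range φ) :=
    ⟨0, by rintro _ ⟨z, rfl⟩; exact div_nonneg (u0 z) (hpos z).le⟩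
  set lo := ⨅ w, φ w with hlo
  have h1 : ∀ z, lo ≤ φ z := fun z => ciInf_le hB z
  have h2 : ∀ z, φ z ≤ lo + c := by
    intro z
    have : φ z - c ≤ lo := le_ciInf fun w => by linarith [hc z w]
    linarith
  have hu : ∀ z, u z = h z * φ z := fun z => by
    simp only [hφ]; field_simp [(hpos z).ne']
  set H := ∫ z, h z ∂(K x) with hH
  set t := (∫ z, u z ∂(K y)) / (∫ z, h z ∂(K y)) with ht
  have hHle : ∀ z, h z ≤ r * H := by
    intro z
    have := integral_mono (μ := K x) (integrable_const (h z)) ((hint x).const_mul r)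
      (fun w => hr z w)
    rw [integral_const_mul] at this
    simpa using this
  have ht1 : lo ≤ t := by
    rw [ht, le_div_iff₀ (hIpos y), ← integral_const_mul]
    apply integral_mono ((hint y).const_mul _) (uint y)
    intro z
    show lo * h z ≤ u z
    rw [hu z]; nlinarith [h1 z, hpos z]
  have ht2 : t ≤ lo + c := by
    rw [ht, div_le_iff₀ (hIpos y), ← integral_const_mul]
    apply integral_mono (uint y) ((hint y).const_mul _)
    intro z
    show u z ≤ (lo + c) * h z
    rw [hu z]; nlinarith [h2 z, hpos z]
  have ho := aux_osc K (fun z => u z - t * h z) (um.sub (hm.const_mul t))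
    (r * H * (lo - t)) (r * H * (lo + c - t)) (fun z => by
      have e1 : h z * (lo - t) ≤ h z * (φ z - t) :=
        mul_le_mul_of_nonneg_left (by linarith [h1 z]) (hpos z).le
      have e2 := mul_le_mul_of_nonneg_right (hHle z) (by linarith : 0 ≤ t - lo)
      show _ ≤ u z - t * h z
      rw [hu z]; nlinarith) (fun z => by
      have e1 : h z * (φ z - t) ≤ h z * (lo + c - t) :=
        mul_le_mul_of_nonneg_left (by linarith [h2 z]) (hpos z).le
      have e2 := mul_le_mul_of_nonneg_right (hHle z) (by linarith : 0 ≤ lo + c - t)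
      show u z - t * h z ≤ _
      rw [hu z]; nlinarith) x y
  rw [integral_sub (uint x) ((hint x).const_mul t), integral_sub (uint y) ((hint y).const_mul t),
    integral_const_mul, integral_const_mul] at ho
  have ht3 : ∫ z, u z ∂(K y) = t * ∫ z, h z ∂(K y) := by
    rw [ht, div_mul_cancel₀ _ (hIpos y).ne']
  rw [ht3] at ho
  have hHp : 0 < H := hIpos x
  rw [sub_le_iff_le_add, div_le_iff₀ hHp]
  nlinarith

theorem aux_Qiter [MeasurableSpace E]
    (G : ℕ → E → ℝ) (M : ℕ → Kernel E E) [∀ k, IsMarkovKernel (M k)]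
    (hGmeas : ∀ k, Measurable (G k)) (hGpos : ∀ k x, 0 < G k x)
    (hGbdd : ∀ k, ∃ C, ∀ x, G k x ≤ C) (f : E → ℝ) (hf : Measurable f)
    (f0 : ∀ x, 0 ≤ f x) (f1 : ∀ x, f x ≤ 1) (k : ℕ) : ∀ p,
    Measurable (Qiter G M p k f) ∧ (∀ x, 0 ≤ Qiter G M p k f x) ∧
    (∃ C, ∀ x, Qiter G M p k f x ≤ C) ∧
    Measurable (Qiter G M p k (fun _ => 1)) ∧ (∀ x, 0 < Qiter G M p k (fun _ => 1) x) ∧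
    (∃ C, ∀ x, Qiter G M p k (fun _ => 1) x ≤ C) ∧
    (∀ x, Qiter G M p k f x ≤ Qiter G M p k (fun _ => 1) x) := by
  induction k with
  | zero =>
    intro p
    exact ⟨hf, f0, ⟨1, f1⟩, measurable_const, fun _ => one_pos, ⟨1, fun _ => le_rfl⟩, f1⟩
  | succ k ih =>
    intro p
    obtain ⟨m1, n1, ⟨C1, c1⟩, m2, n2, ⟨C2, c2⟩, l⟩ := ih (p + 1)
    obtain ⟨D, hD⟩ := hGbdd (p + 1)
    have i1 : ∀ x, Integrable (Qiter G M (p+1) k f) (M (p+1) x) := fun x =>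
      aux_bdd_integrable _ _ m1 0 C1 n1 c1
    have i2 : ∀ x, Integrable (Qiter G M (p+1) k (fun _ => 1)) (M (p+1) x) := fun x =>
      aux_bdd_integrable _ _ m2 0 C2 (fun z => (n2 z).le) c2
    have hle : ∀ x, Qiter G M p (k+1) f x ≤ Qiter G M p (k+1) (fun _ => 1) x := fun x =>
      mul_le_mul_of_nonneg_left (integral_mono (i1 x) (i2 x) l) (hGpos _ x).le
    have hC : ∀ x, Qiter G M p (k+1) (fun _ => 1) x ≤ D * C2 := by
      intro x
      have e1 : ∫ z, Qiter G M (p+1) k (fun _ => 1) z ∂(M (p+1) x) ≤ C2 := by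
        have := integral_mono (i2 x) (integrable_const C2) c2
        simpa using this
      have e2 : 0 ≤ ∫ z, Qiter G M (p+1) k (fun _ => 1) z ∂(M (p+1) x) :=
        integral_nonneg fun z => (n2 z).le
      exact mul_le_mul (hD x) e1 e2 ((hGpos _ x).le.trans (hD x))
    refine ⟨?_, ?_, ⟨D * C2, fun x => (hle x).trans (hC x)⟩, ?_, ?_, ⟨D * C2, hC⟩, hle⟩
    · exact (hGmeas (p+1)).mul (m1.stronglyMeasurable.integral_kernel (κ := M (p+1))).measurable
    · exact fun x => mul_nonneg (hGpos _ x).le (integral_nonneg n1)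
    · exact (hGmeas (p+1)).mul (m2.stronglyMeasurable.integral_kernel (κ := M (p+1))).measurable
    · intro x
      refine mul_pos (hGpos _ x) ?_
      rw [integral_pos_iff_support_of_nonneg (fun z => (n2 z).le) (i2 x)]
      have : Function.support (Qiter G M (p+1) k (fun _ => 1)) = Set.univ := by
        ext z; simp [(n2 z).ne']
      rw [this]; simp

/-- Let `a ∈ (0,1)` and `α = a/(1−a)`. Assume the sequence `(g_p)` is
decreasing with `g_p > 1`, and for every `p ≥ 1` that
`b_p ≤ (g_p^α − 1)/(g_p^{α+1} − 1)` and `b_p ≤ a/g_p^{α+1}` (real powers). Then for all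
`p ≤ n`: (i) `g_{p,n} ≤ (g_{p+1})^{1+α}`; (ii) `g_{p−1,n} · b_p ≤ a` (for `1 ≤ p ≤ n`);
and (iii) `g_{p,n} · b_{p,n} ≤ a^{n−p}`. -/
theorem fk_decreasing_estimates [MeasurableSpace E] [Nonempty E]
    (G : ℕ → E → ℝ) (M : ℕ → Kernel E E) [∀ k, IsMarkovKernel (M k)]
    (hGmeas : ∀ k, Measurable (G k))
    (hGpos : ∀ k x, 0 < G k x)
    (hGbdd : ∀ k, ∃ C, ∀ x, G k x ≤ C)
    (hgfin : ∀ k, BddAbove (Set.range fun q : E × E => G k q.1 / G k q.2))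
    (a : ℝ) (ha0 : 0 < a) (ha1 : a < 1)
    (α : ℝ) (hα : α = a / (1 - a))
    (hgdec : ∀ p q, p ≤ q → glit G q ≤ glit G p)
    (hg1 : ∀ p, 1 < glit G p)
    (hb1 : ∀ p, 1 ≤ p → blit M p ≤ (glit G p ^ α - 1) / (glit G p ^ (α + 1) - 1))
    (hb2 : ∀ p, 1 ≤ p → blit M p ≤ a / glit G p ^ (α + 1)) :
    (∀ p n, p ≤ n → gpn G M p n ≤ glit G (p + 1) ^ (1 + α)) ∧
    (∀ p n, 1 ≤ p → p ≤ n → gpn G M (p - 1) n * blit M p ≤ a) ∧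
    (∀ p n, p ≤ n → gpn G M p n * bpn G M p n ≤ a ^ (n - p)) := by
  have hα0 : 0 < α := by rw [hα]; exact div_pos ha0 (by linarith)
  have hQ1 := fun k p => aux_Qiter G M hGmeas hGpos hGbdd (fun _ => 1) measurable_const
    (fun _ => zero_le_one) (fun _ => le_rfl) k p
  have hGr : ∀ k x y, G k x ≤ glit G k * G k y := by
    intro k x y
    have := le_ciSup (hgfin k) (x, y)
    rwa [div_le_iff₀ (hGpos k y)] at this
  have hb0 : ∀ p, 0 ≤ blit M p := fun p => (aux_kernel_bdd (M p)).2
  have key : ∀ k p x y, Qiter G M p k (fun _ => 1) x ≤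
      glit G (p + 1) ^ (1 + α) * Qiter G M p k (fun _ => 1) y := by
    intro k
    induction k with
    | zero =>
      intro p x y
      simpa [Qiter] using Real.one_le_rpow (hg1 (p+1)).le (by linarith)
    | succ k ih =>
      intro p x y
      obtain ⟨m, -, -, -, pos, -, -⟩ := hQ1 k (p + 1)
      set g := glit G (p + 1) with hg
      have hgg : 1 < g := hg1 _
      have hr : ∀ x y, Qiter G M (p+1) k (fun _ => 1) x ≤
          g ^ (1 + α) * Qiter G M (p+1) k (fun _ => 1) y := by
        intro x y
        refine (ih (p+1) x y).trans (mul_le_mul_of_nonneg_right ?_ (pos y).le)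
        exact Real.rpow_le_rpow (by linarith [hg1 (p+1+1)]) (hgdec _ _ (by omega)) (by linarith)
      have h1 := aux_ratio (M (p+1)) _ m pos _ hr x y
      have hI : ∀ x, 0 ≤ ∫ z, Qiter G M (p+1) k (fun _ => 1) z ∂(M (p+1) x) :=
        fun x => integral_nonneg fun z => (pos z).le
      have h2 : 1 + dobF (kernelSF (M (p+1))) * (g ^ (1 + α) - 1) ≤ g ^ α := by
        have h3 := hb1 (p+1) (by omega)
        rw [← hg, add_comm α 1, le_div_iff₀
          (by linarith [Real.one_lt_rpow hgg (by linarith : 0 < 1 + α)])] at h3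
        have : blit M (p+1) = dobF (kernelSF (M (p+1))) := rfl
        rw [this] at h3
        linarith
      have h4 : g ^ (1 + α) = g * g ^ α := by
        rw [Real.rpow_add (by linarith), Real.rpow_one]
      show G (p+1) x * _ ≤ g ^ (1 + α) * (G (p+1) y * _)
      calc _ ≤ (g * G (p+1) y) * (g ^ α * ∫ z, Qiter G M (p+1) k (fun _ => 1) z ∂(M (p+1) y)) :=
            mul_le_mul (hGr _ x y) (h1.trans (mul_le_mul_of_nonneg_right h2 (hI y))) (hI x)
              (mul_nonneg (by linarith) (hGpos _ y).le)
        _ = _ := by rw [h4]; ring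
  have hi : ∀ p n, gpn G M p n ≤ glit G (p + 1) ^ (1 + α) := by
    intro p n
    apply ciSup_le
    rintro ⟨x, y⟩
    exact (div_le_iff₀ ((hQ1 (n - p) p).2.2.2.2.1 y)).2 (key (n - p) p x y)
  have hrat : ∀ p n x y, Gpn G M p n x ≤ gpn G M p n * Gpn G M p n y := by
    intro p n x y
    have hB : BddAbove (Set.range fun q : E × E => Gpn G M p n q.1 / Gpn G M p n q.2) := by
      refine ⟨glit G (p + 1) ^ (1 + α), ?_⟩
      rintro _ ⟨⟨x, y⟩, rfl⟩
      exact (div_le_iff₀ ((hQ1 (n - p) p).2.2.2.2.1 y)).2 (key (n - p) p x y)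
    have := le_ciSup hB (x, y)
    exact (div_le_iff₀ ((hQ1 (n - p) p).2.2.2.2.1 y)).1 this
  have hgn0 : ∀ p n, 0 ≤ gpn G M p n := fun p n => Real.iSup_nonneg fun q =>
    div_nonneg ((hQ1 (n - p) p).2.2.2.2.1 _).le ((hQ1 (n - p) p).2.2.2.2.1 _).le
  have hii : ∀ p n, gpn G M p n * blit M (p + 1) ≤ a := by
    intro p n
    have hgp : 0 < glit G (p+1) ^ (1 + α) := Real.rpow_pos_of_pos (by linarith [hg1 (p+1)]) _
    have h3 := hb2 (p+1) (by omega)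
    rw [add_comm α 1, le_div_iff₀ hgp] at h3
    have := mul_le_mul_of_nonneg_right (hi p n) (hb0 (p+1))
    linarith
  refine ⟨fun p n _ => hi p n, ?_, ?_⟩
  · intro p n hp _
    obtain ⟨p, rfl⟩ := Nat.exists_eq_add_of_le' hp
    exact hii p n
  · have hind : ∀ A : Set E, MeasurableSet A → ∀ k p, _ := fun A hA k p =>
      aux_Qiter G M hGmeas hGpos hGbdd (A.indicator fun _ => 1)
        (measurable_const.indicator hA) (fun x => Set.indicator_nonneg (fun _ _ => zero_le_one) x)
        (fun x => Set.indicator_le_self' (fun _ _ => zero_le_one) x) k p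
    have hP : ∀ p n, (∀ x y A, MeasurableSet A → |Ppn G M p n x A - Ppn G M p n y A| ≤
        bpn G M p n) ∧ 0 ≤ bpn G M p n := by
      intro p n
      apply aux_dob_bdd
      · intro x A hA
        obtain ⟨-, n1, -, -, n2, -, l⟩ := hind A hA (n - p) p
        exact div_nonneg (n1 x) (n2 x).le
      · intro x A hA
        obtain ⟨-, n1, -, -, n2, -, l⟩ := hind A hA (n - p) p
        exact (div_le_one (n2 x)).2 (l x)
    obtain ⟨x0⟩ := id ‹Nonempty E›
    haveI : Nonempty (E × E × {A : Set E // MeasurableSet A}) :=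
      ⟨(x0, x0, ⟨∅, MeasurableSet.empty⟩)⟩
    have main : ∀ k p, gpn G M p (p + k) * bpn G M p (p + k) ≤ a ^ k := by
      intro k
      induction k with
      | zero =>
        intro p
        have e1 : gpn G M p (p + 0) ≤ 1 := by
          apply ciSup_le
          intro q
          simp [Gpn, Qpn, Qiter]
        have e2 : bpn G M p (p + 0) ≤ 1 := by
          apply ciSup_le
          rintro ⟨x, y, A, hA⟩
          obtain ⟨-, n1, -, -, n2, -, l⟩ := hind A hA (p + 0 - p) p
          have a1 : 0 ≤ Ppn G M p (p+0) x A := div_nonneg (n1 x) (n2 x).le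
          have a2 : Ppn G M p (p+0) x A ≤ 1 := (div_le_one (n2 x)).2 (l x)
          have a3 : 0 ≤ Ppn G M p (p+0) y A := div_nonneg (n1 y) (n2 y).le
          have a4 : Ppn G M p (p+0) y A ≤ 1 := (div_le_one (n2 y)).2 (l y)
          exact abs_le.2 ⟨by linarith, by linarith⟩
        have := mul_le_mul e1 e2 (hP _ _).2 zero_le_one
        simpa using this
      | succ k ih =>
        intro p
        have hn : p + (k + 1) = (p + 1) + k := by omega
        have hnk : (p + 1) + k - (p + 1) = k := by omega
        have hnk' : (p + 1) + k - p = k + 1 := by omega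
        rw [hn]
        have hstep : bpn G M p (p + 1 + k) ≤
            gpn G M (p+1) (p+1+k) * blit M (p+1) * bpn G M (p+1) (p+1+k) := by
          apply ciSup_le
          rintro ⟨x, y, A, hA⟩
          obtain ⟨m1, n1, -, m2, n2, -, l⟩ := hind A hA k (p + 1)
          have hr := hrat (p+1) (p+1+k)
          have hc := (hP (p+1) (p+1+k)).1
          simp only [Gpn, Qpn, Ppn, hnk] at hr hc
          have hcon := aux_contr (M (p+1)) _ _ m2 m1 n2 n1 l _ _ hr
            (fun x y => (le_abs_self _).trans (hc x y A hA))
          have hPe : ∀ x, Ppn G M p (p+1+k) x A =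
              (∫ z, Qiter G M (p+1) k (A.indicator fun _ => 1) z ∂(M (p+1) x)) /
              (∫ z, Qiter G M (p+1) k (fun _ => 1) z ∂(M (p+1) x)) := by
            intro x
            simp only [Ppn, Gpn, Qpn, hnk', Qiter, Qop]
            exact mul_div_mul_left _ _ (hGpos _ x).ne'
          simp only [hPe]
          have c1 := hcon x y
          have c2 := hcon y x
          exact abs_le.2 ⟨by unfold blit; linarith, c1⟩
        have h1 := hii p (p+1+k)
        have h2 := ih (p+1)
        calc _ ≤ gpn G M p (p+1+k) *
              (gpn G M (p+1) (p+1+k) * blit M (p+1) * bpn G M (p+1) (p+1+k)) :=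
              mul_le_mul_of_nonneg_left hstep (hgn0 _ _)
          _ = (gpn G M p (p+1+k) * blit M (p+1)) *
              (gpn G M (p+1) (p+1+k) * bpn G M (p+1) (p+1+k)) := by ring
          _ ≤ a * a ^ k := mul_le_mul h1 h2 (mul_nonneg (hgn0 _ _) (hP _ _).2) ha0.le
          _ = _ := by ring
    intro p n hpn
    obtain ⟨k, rfl⟩ := Nat.exists_eq_add_of_le hpn
    rw [Nat.add_sub_cancel_left]
    exact main k p
end

section
/- Let (G_p) be bounded measurable positive potential functions and (M_p) Markov kernels on a measurable space E, with associated Feynman-Kac semigroup transformations φ_{p,n} and quantities g_{p,n}, b_{p,n} as defined below. Then for any probability measures μ and ν on E and any integers p ≤ n, ‖φ_{p,n}(μ) − φ_{p,n}(ν)‖_tv ≤ g_{p,n} · b_{p,n} · ‖μ − ν‖_tv. -/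
open MeasureTheory ProbabilityTheory

variable {E : Type*}

/-- The Feynman-Kac semigroup transformation evaluated on a measurable set:
`φ_{p,n}(μ)(A) = μ(Q_{p,n}.1_A) / μ(Q_{p,n}.1)`. -/
noncomputable def phiVal [MeasurableSpace E] (G : ℕ → E → ℝ) (M : ℕ → Kernel E E)
    (p n : ℕ) (μ : Measure E) (A : Set E) : ℝ :=
  (∫ x, Qpn G M p n (A.indicator fun _ => 1) x ∂μ) / ∫ x, Gpn G M p n x ∂μ

lemma fkAux_Qiter [MeasurableSpace E]
    (G : ℕ → E → ℝ) (M : ℕ → Kernel E E) [∀ k, IsMarkovKernel (M k)]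
    (hGmeas : ∀ k, Measurable (G k))
    (hGpos : ∀ k x, 0 < G k x)
    (hGbdd : ∀ k, ∃ C, ∀ x, G k x ≤ C) (f g : E → ℝ) (hf : Measurable f) (hg : Measurable g)
    (h0 : ∀ x, 0 ≤ f x) (hfg : ∀ x, f x ≤ g x) (hgp : ∀ x, 0 < g x)
    (hgC : ∃ C, ∀ x, g x ≤ C) (k : ℕ) : ∀ p : ℕ,
    Measurable (Qiter G M p k f) ∧ Measurable (Qiter G M p k g) ∧
    (∀ x, 0 ≤ Qiter G M p k f x) ∧ (∀ x, Qiter G M p k f x ≤ Qiter G M p k g x) ∧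
    (∀ x, 0 < Qiter G M p k g x) ∧ (∃ C, ∀ x, Qiter G M p k g x ≤ C) := by
  induction k with
  | zero => intro p; exact ⟨hf, hg, h0, hfg, hgp, hgC⟩
  | succ k ih =>
    intro p
    obtain ⟨mf, mg, f0, fg, gp, C, hC⟩ := ih (p + 1)
    have ig : ∀ x, Integrable (Qiter G M (p+1) k g) (M (p+1) x) := fun x =>
      Integrable.of_bound mg.aestronglyMeasurable C (ae_of_all _ fun y => by
        rw [Real.norm_of_nonneg (gp y).le]; exact hC y)
    have iff' : ∀ x, Integrable (Qiter G M (p+1) k f) (M (p+1) x) := fun x =>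
      Integrable.of_bound mf.aestronglyMeasurable C (ae_of_all _ fun y => by
        rw [Real.norm_of_nonneg (f0 y)]; exact (fg y).trans (hC y))
    obtain ⟨D, hD⟩ := hGbdd (p+1)
    refine ⟨?_, ?_, ?_, ?_, ?_, D * C, ?_⟩
    · exact (hGmeas _).mul (mf.stronglyMeasurable.integral_kernel (κ := M (p+1))).measurable
    · exact (hGmeas _).mul (mg.stronglyMeasurable.integral_kernel (κ := M (p+1))).measurable
    · intro x
      exact mul_nonneg (hGpos _ x).le (integral_nonneg f0)
    · intro x
      exact mul_le_mul_of_nonneg_left (integral_mono (iff' x) (ig x) fg) (hGpos _ x).le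
    · intro x
      refine mul_pos (hGpos _ x) ?_
      rw [integral_pos_iff_support_of_nonneg (fun y => (gp y).le) (ig x)]
      have : Function.support (Qiter G M (p+1) k g) = Set.univ := by
        ext y; simp [(gp y).ne']
      rw [this]; simp
    · intro x
      have h1 : ∫ y, Qiter G M (p+1) k g y ∂(M (p+1) x) ≤ C := by
        have := integral_mono (ig x) (integrable_const C) hC
        simpa using this
      exact mul_le_mul (hD x) h1 (integral_nonneg fun y => (gp y).le)
        ((hGpos _ x).le.trans (hD x))

lemma fkAux_tv_le [MeasurableSpace E] (μ ν : Measure E) [IsProbabilityMeasure μ]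
    [IsProbabilityMeasure ν] (A : Set E) (hA : MeasurableSet A) :
    |μ.real A - ν.real A| ≤ tvDist μ ν := by
  refine le_ciSup (f := fun A : {A : Set E // MeasurableSet A} =>
    |(μ A.1).toReal - (ν A.1).toReal|) ?_ ⟨A, hA⟩
  refine ⟨1, ?_⟩
  rintro _ ⟨B, rfl⟩
  have h1 : μ.real B.1 ≤ 1 := measureReal_le_one
  have h2 : ν.real B.1 ≤ 1 := measureReal_le_one
  have h3 : 0 ≤ μ.real B.1 := measureReal_nonneg
  have h4 : 0 ≤ ν.real B.1 := measureReal_nonneg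
  change |μ.real B.1 - ν.real B.1| ≤ 1
  rw [abs_le]; constructor <;> linarith

lemma fkAux_integral [MeasurableSpace E] (μ ν : Measure E) [IsProbabilityMeasure μ]
    [IsProbabilityMeasure ν] (f : E → ℝ) (hf : Measurable f) (a b : ℝ) (hab : a ≤ b)
    (ha : ∀ x, a ≤ f x) (hb : ∀ x, f x ≤ b) :
    |∫ x, f x ∂μ - ∫ x, f x ∂ν| ≤ (b - a) * tvDist μ ν := by
  have key : ∀ (ρ : Measure E) [IsProbabilityMeasure ρ],
      ∫ x, f x ∂ρ = a + (∫ t in Set.Ioc 0 (b - a), ρ.real {x | t ≤ f x - a}) ∧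
      IntegrableOn (fun t => ρ.real {x | t ≤ f x - a}) (Set.Ioc 0 (b - a)) := by
    intro ρ _
    have i1 : Integrable f ρ := Integrable.of_bound hf.aestronglyMeasurable (max |a| |b|)
      (ae_of_all _ fun y => abs_le_max_abs_abs (ha y) (hb y))
    have i2 : Integrable (fun x => f x - a) ρ := i1.sub (integrable_const a)
    have e := i2.integral_eq_integral_Ioc_meas_le (M := b - a)
      (ae_of_all _ fun y => sub_nonneg.2 (ha y))
      (ae_of_all _ fun y => sub_le_sub_right (hb y) a)
    refine ⟨?_, ?_⟩
    · rw [← e, integral_sub i1 (integrable_const a)]; simp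
    · have : Antitone (fun t => ρ.real {x | t ≤ f x - a}) := fun s t hst =>
        measureReal_mono (fun x (hx : t ≤ f x - a) => hst.trans hx)
      exact ((this.antitoneOn _).integrableOn_isCompact isCompact_Icc).mono_set
        Set.Ioc_subset_Icc_self
  obtain ⟨e1, i1⟩ := key μ
  obtain ⟨e2, i2⟩ := key ν
  rw [e1, e2, add_sub_add_left_eq_sub, ← integral_sub i1 i2]
  have := norm_setIntegral_le_of_norm_le_const (μ := volume) (s := Set.Ioc 0 (b - a))
    (f := fun t => μ.real {x | t ≤ f x - a} - ν.real {x | t ≤ f x - a}) (C := tvDist μ ν)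
    (by simp) (fun t _ => fkAux_tv_le μ ν _
      (measurableSet_le measurable_const (hf.sub measurable_const)))
  rw [Real.norm_eq_abs] at this
  refine this.trans (le_of_eq ?_)
  rw [Real.volume_real_Ioc_of_le (by linarith)]; ring

/-- For any probability measures `μ`, `ν` and `p ≤ n`, the Feynman-Kac
semigroup satisfies `‖φ_{p,n}(μ) − φ_{p,n}(ν)‖_tv ≤ g_{p,n} · b_{p,n} · ‖μ − ν‖_tv`,
stated via `|φ_{p,n}(μ)(A) − φ_{p,n}(ν)(A)| ≤ g_{p,n} · b_{p,n} · ‖μ − ν‖_tv` for every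
measurable set `A`. -/
theorem fk_semigroup_tv_contraction [MeasurableSpace E] [Nonempty E]
    (G : ℕ → E → ℝ) (M : ℕ → Kernel E E) [∀ k, IsMarkovKernel (M k)]
    (hGmeas : ∀ k, Measurable (G k))
    (hGpos : ∀ k x, 0 < G k x)
    (hGbdd : ∀ k, ∃ C, ∀ x, G k x ≤ C)
    (hgpnfin : ∀ p n, BddAbove (Set.range fun q : E × E => Gpn G M p n q.1 / Gpn G M p n q.2))
    (μ ν : Measure E) [IsProbabilityMeasure μ] [IsProbabilityMeasure ν]
    (p n : ℕ) (hpn : p ≤ n) :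
    ∀ A : Set E, MeasurableSet A →
      |phiVal G M p n μ A - phiVal G M p n ν A| ≤ gpn G M p n * bpn G M p n * tvDist μ ν := by
  intro A hA
  set F := Gpn G M p n with hF
  set q := Qpn G M p n (A.indicator fun _ => 1) with hq
  obtain ⟨mq, mF, q0, qF, F0, C, hC⟩ : Measurable q ∧ Measurable F ∧ (∀ x, 0 ≤ q x) ∧
      (∀ x, q x ≤ F x) ∧ (∀ x, 0 < F x) ∧ ∃ C, ∀ x, F x ≤ C :=
    fkAux_Qiter G M hGmeas hGpos hGbdd (A.indicator fun _ => 1) (fun _ => 1)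
      (measurable_const.indicator hA) measurable_const
      (fun x => Set.indicator_nonneg (fun _ _ => zero_le_one) x)
      (fun x => Set.indicator_le_self' (fun _ _ => zero_le_one) x)
      (fun _ => one_pos) ⟨1, fun _ => le_rfl⟩ (n - p) p
  have osc : ∀ x y, q x / F x - q y / F y ≤ bpn G M p n := by
    intro x y
    refine (le_abs_self _).trans ?_
    refine le_ciSup (f := fun r : E × E × {A : Set E // MeasurableSet A} =>
      |Ppn G M p n r.1 r.2.2.1 - Ppn G M p n r.2.1 r.2.2.1|) ?_ (x, y, ⟨A, hA⟩)
    refine ⟨1, ?_⟩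
    rintro _ ⟨⟨u, v, B, hB⟩, rfl⟩
    obtain ⟨-, -, r0, rF, -, -⟩ :=
      fkAux_Qiter G M hGmeas hGpos hGbdd (B.indicator fun _ => 1) (fun _ => 1)
      (measurable_const.indicator hB) measurable_const
      (fun x => Set.indicator_nonneg (fun _ _ => zero_le_one) x)
      (fun x => Set.indicator_le_self' (fun _ _ => zero_le_one) x)
      (fun _ => one_pos) ⟨1, fun _ => le_rfl⟩ (n - p) p
    have P0 : ∀ z, 0 ≤ Ppn G M p n z B := fun z => div_nonneg (r0 z) (F0 z).le
    have P1 : ∀ z, Ppn G M p n z B ≤ 1 := fun z => (div_le_one (F0 z)).2 (rF z)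
    change |Ppn G M p n u B - Ppn G M p n v B| ≤ 1
    rw [abs_le]; constructor <;> linarith [P0 u, P0 v, P1 u, P1 v]
  have hg : ∀ x y, F x ≤ gpn G M p n * F y := by
    intro x y
    rw [← div_le_iff₀ (F0 y)]
    exact le_ciSup (f := fun r : E × E => F r.1 / F r.2) (hgpnfin p n) (x, y)
  set g := gpn G M p n
  set b := bpn G M p n
  have htv : 0 ≤ tvDist μ ν := (abs_nonneg _).trans (fkAux_tv_le μ ν ∅ MeasurableSet.empty)
  obtain ⟨x0⟩ := ‹Nonempty E›
  set h : E → ℝ := fun x => q x / F x with hh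
  have h0 : ∀ x, 0 ≤ h x := fun x => div_nonneg (q0 x) (F0 x).le
  have h1 : ∀ x, h x ≤ 1 := fun x => (div_le_one (F0 x)).2 (qF x)
  have hqh : ∀ x, q x = F x * h x := fun x => by
    have := (F0 x).ne'
    simp only [hh]; field_simp
  have : Nonempty E := ⟨x0⟩
  have bF : BddAbove (Set.range F) := ⟨C, by rintro _ ⟨x, rfl⟩; exact hC x⟩
  have ba : BddAbove (Set.range h) := ⟨1, by rintro _ ⟨x, rfl⟩; exact h1 x⟩
  have bb : BddBelow (Set.range h) := ⟨0, by rintro _ ⟨x, rfl⟩; exact h0 x⟩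
  set S := ⨆ x, F x
  set m := ⨅ x, h x
  set T := ⨆ x, h x
  have FS : ∀ x, F x ≤ S := fun x => le_ciSup bF x
  have hm : ∀ x, m ≤ h x := fun x => ciInf_le bb x
  have hT : ∀ x, h x ≤ T := fun x => le_ciSup ba x
  have S0 : 0 < S := (F0 x0).trans_le (FS x0)
  have Sg : ∀ y, S ≤ g * F y := fun y => ciSup_le fun x => hg x y
  have hTm : T - m ≤ b := by
    have : T ≤ m + b := ciSup_le fun x => by
      have : h x - b ≤ m := le_ciInf fun y => by
        have : h x - h y ≤ b := osc x y
        linarith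
      linarith
    linarith
  have b0 : 0 ≤ b := by
    have : h x0 - h x0 ≤ b := osc x0 x0
    linarith
  have iF : ∀ (ρ : Measure E) [IsProbabilityMeasure ρ], Integrable F ρ := fun ρ _ =>
    Integrable.of_bound mF.aestronglyMeasurable C (ae_of_all _ fun y => by
        rw [Real.norm_of_nonneg (F0 y).le]; exact hC y)
  have iq : ∀ (ρ : Measure E) [IsProbabilityMeasure ρ], Integrable q ρ := fun ρ _ =>
    Integrable.of_bound mq.aestronglyMeasurable C (ae_of_all _ fun y => by
        rw [Real.norm_of_nonneg (q0 y)]; exact (qF y).trans (hC y))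
  have IF : ∀ (ρ : Measure E) [IsProbabilityMeasure ρ], 0 < ∫ x, F x ∂ρ := fun ρ _ => by
    rw [integral_pos_iff_support_of_nonneg (fun y => (F0 y).le) (iF ρ)]
    have : Function.support F = Set.univ := by
      ext y; simp [(F0 y).ne']
    rw [this]; simp
  have SgI : S ≤ g * ∫ x, F x ∂μ := by
    have := integral_mono (integrable_const S) ((iF μ).const_mul g) Sg
    rw [integral_const_mul] at this
    simpa using this
  change |(∫ x, q x ∂μ) / (∫ x, F x ∂μ) - (∫ x, q x ∂ν) / (∫ x, F x ∂ν)| ≤ _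
  set c := (∫ x, q x ∂ν) / (∫ x, F x ∂ν) with hc
  have cm : m ≤ c := by
    rw [hc, le_div_iff₀ (IF ν), ← integral_const_mul]
    refine integral_mono ((iF ν).const_mul m) (iq ν) fun x => ?_
    change m * F x ≤ q x
    rw [hqh x, mul_comm]
    exact mul_le_mul_of_nonneg_left (hm x) (F0 x).le
  have cT : c ≤ T := by
    rw [hc, div_le_iff₀ (IF ν), ← integral_const_mul]
    refine integral_mono (iq ν) ((iF ν).const_mul T) fun x => ?_
    change q x ≤ T * F x
    rw [hqh x, mul_comm T]
    exact mul_le_mul_of_nonneg_left (hT x) (F0 x).le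
  have e : ∀ (ρ : Measure E) [IsProbabilityMeasure ρ],
      ∫ x, (q x - c * F x) ∂ρ = (∫ x, q x ∂ρ) - c * ∫ x, F x ∂ρ := fun ρ _ => by
    rw [integral_sub (iq ρ) ((iF ρ).const_mul c), integral_const_mul]
  have eν : ∫ x, (q x - c * F x) ∂ν = 0 := by
    rw [e ν, hc, div_mul_cancel₀ _ (IF ν).ne', sub_self]
  have main := fkAux_integral μ ν (fun x => q x - c * F x) (mq.sub (mF.const_mul c))
    (S * (m - c)) (S * (T - c)) (mul_le_mul_of_nonneg_left (by linarith) S0.le)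
    (fun x => by
      rw [hqh x]
      nlinarith [mul_nonneg (F0 x).le (sub_nonneg.2 (hm x)),
        mul_nonneg (sub_nonneg.2 (FS x)) (sub_nonneg.2 cm)])
    (fun x => by
      rw [hqh x]
      nlinarith [mul_nonneg (F0 x).le (sub_nonneg.2 (hT x)),
        mul_nonneg (sub_nonneg.2 (FS x)) (sub_nonneg.2 cT)])
  rw [eν, sub_zero, e μ] at main
  have e3 : (∫ x, q x ∂μ) / (∫ x, F x ∂μ) - c
      = ((∫ x, q x ∂μ) - c * ∫ x, F x ∂μ) / ∫ x, F x ∂μ := by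
    have := (IF μ).ne'
    field_simp
  rw [e3, abs_div, abs_of_pos (IF μ), div_le_iff₀ (IF μ)]
  refine main.trans ?_
  calc (S * (T - c) - S * (m - c)) * tvDist μ ν = S * (T - m) * tvDist μ ν := by ring
    _ ≤ S * b * tvDist μ ν :=
      mul_le_mul_of_nonneg_right (mul_le_mul_of_nonneg_left hTm S0.le) htv
    _ ≤ (g * ∫ x, F x ∂μ) * b * tvDist μ ν :=
      mul_le_mul_of_nonneg_right (mul_le_mul_of_nonneg_right SgI b0) htv
    _ = _ := by ring
end

section
/- Let X be a nonnegative random variable and ε > 0 a constant such that for every integer p ≥ 1, E(X^p)^{1/p} ≤ B_p · ε, where B_{2p} = ((2p)!/(2^p·p!))^{1/(2p)} and B_{2p+1} = ((2p+1)!/(2^p·p!·√(2p+1)))^{1/(2p+1)}. Then for every t ≥ 0, the Laplace transform satisfies E(e^{tX}) ≤ (1 + t·ε)·e^{t²ε²/2}. -/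
open MeasureTheory

/-- The Khintchine-type constants `B_p`, defined by
`B_{2k}^{2k} = (2k)!/(2^k·k!)` and `B_{2k+1}^{2k+1} = (2k+1)!/(2^k·k!·√(2k+1))`. -/
noncomputable def Bconst (p : ℕ) : ℝ :=
  if p % 2 = 0 then
    ((p.factorial : ℝ) / (2 ^ (p / 2) * (p / 2).factorial)) ^ ((p : ℝ)⁻¹)
  else
    ((p.factorial : ℝ) / (2 ^ (p / 2) * (p / 2).factorial * Real.sqrt p)) ^ ((p : ℝ)⁻¹)

theorem Bconst_pow_le (p : ℕ) (hp : 1 ≤ p) :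
    0 ≤ Bconst p ∧ Bconst p ^ p ≤ (p.factorial : ℝ) / (2 ^ (p / 2) * (p / 2).factorial) := by
  have hp0 : p ≠ 0 := by omega
  unfold Bconst
  split_ifs with h
  · refine ⟨by positivity, ?_⟩
    rw [Real.rpow_inv_natCast_pow (by positivity) hp0]
  · refine ⟨by positivity, ?_⟩
    rw [Real.rpow_inv_natCast_pow (by positivity) hp0]
    have h1 : (1 : ℝ) ≤ Real.sqrt p := by
      rw [Real.one_le_sqrt]; exact_mod_cast hp
    have h2 : (0 : ℝ) < 2 ^ (p / 2) * (p / 2).factorial := by positivity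
    apply div_le_div_of_nonneg_left (by positivity) h2
    exact le_mul_of_one_le_right h2.le h1

/-- The comparison series. -/
noncomputable def cterm (s : ℝ) (n : ℕ) : ℝ :=
  s ^ n / (2 ^ (n / 2) * (n / 2).factorial)

theorem cterm_hasSum (s : ℝ) :
    HasSum (cterm s) ((1 + s) * Real.exp (s ^ 2 / 2)) := by
  have he : HasSum (fun k : ℕ => (s ^ 2 / 2) ^ k / (k.factorial : ℝ)) (Real.exp (s ^ 2 / 2)) := by
    rw [Real.exp_eq_exp_ℝ]
    exact NormedSpace.expSeries_div_hasSum_exp (s ^ 2 / 2)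
  have h1 : HasSum (fun k : ℕ => cterm s (2 * k)) (Real.exp (s ^ 2 / 2)) := by
    convert he using 2 with k
    unfold cterm
    rw [show 2 * k / 2 = k by omega, pow_mul, div_pow, div_div]
  have h2 : HasSum (fun k : ℕ => cterm s (2 * k + 1)) (s * Real.exp (s ^ 2 / 2)) := by
    have h3 := he.mul_left s
    refine (congrArg (fun f => HasSum f (s * Real.exp (s ^ 2 / 2))) (funext fun k => ?_)).mpr h3
    unfold cterm
    rw [show (2 * k + 1) / 2 = k by omega, pow_succ, pow_mul, div_pow, div_div]
    ring
  have := h1.even_add_odd h2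
  convert this using 1
  ring

/-- If a nonnegative random variable `X` satisfies
`E(X^p)^{1/p} ≤ B_p · ε` for every `p ≥ 1`, then for every `t ≥ 0` its Laplace transform
satisfies `E(e^{tX}) ≤ (1 + t ε) e^{t² ε² / 2}`. -/
theorem laplace_transform_bound {Ω : Type*} [MeasurableSpace Ω]
    (P : Measure Ω) [IsProbabilityMeasure P]
    (X : Ω → ℝ) (hXmeas : Measurable X) (hXnonneg : ∀ ω, 0 ≤ X ω)
    (ε : ℝ) (hε : 0 < ε)
    (hint : ∀ p : ℕ, 1 ≤ p → Integrable (fun ω => X ω ^ p) P)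
    (hmom : ∀ p : ℕ, 1 ≤ p → (∫ ω, X ω ^ p ∂P) ^ ((p : ℝ)⁻¹) ≤ Bconst p * ε) :
    ∀ t : ℝ, 0 ≤ t →
      ∫ ω, Real.exp (t * X ω) ∂P ≤ (1 + t * ε) * Real.exp (t ^ 2 * ε ^ 2 / 2) := by
  intro t ht
  have hbound : ∀ n : ℕ, ∫ ω, (t * X ω) ^ n / (n.factorial : ℝ) ∂P ≤ cterm (t * ε) n := by
    intro n
    rcases Nat.eq_zero_or_pos n with rfl | hn
    · simp [cterm]
    · have hm : 0 ≤ ∫ ω, X ω ^ n ∂P := integral_nonneg fun ω => pow_nonneg (hXnonneg ω) n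
      obtain ⟨hB, hBp⟩ := Bconst_pow_le n hn
      have h1 : ∫ ω, X ω ^ n ∂P ≤ (Bconst n * ε) ^ n := by
        have := pow_le_pow_left₀ (Real.rpow_nonneg hm _) (hmom n hn) n
        rwa [Real.rpow_inv_natCast_pow hm (by omega)] at this
      have h2 : ∫ ω, X ω ^ n ∂P ≤
          (n.factorial : ℝ) / (2 ^ (n / 2) * (n / 2).factorial) * ε ^ n := by
        refine h1.trans ?_
        rw [mul_pow]
        gcongr
      have h3 : ∫ ω, (t * X ω) ^ n / (n.factorial : ℝ) ∂P =
          t ^ n / (n.factorial : ℝ) * ∫ ω, X ω ^ n ∂P := by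
        rw [← integral_const_mul]
        congr 1
        ext ω
        ring
      rw [h3]
      refine (mul_le_mul_of_nonneg_left h2 (by positivity)).trans (le_of_eq ?_)
      unfold cterm
      have : (n.factorial : ℝ) ≠ 0 := by positivity
      rw [mul_pow]
      field_simp
  have hnn : ∀ n ω, 0 ≤ (t * X ω) ^ n / (n.factorial : ℝ) := fun n ω => by
    have := hXnonneg ω
    positivity
  have hI : ∀ n : ℕ, Integrable (fun ω => (t * X ω) ^ n / (n.factorial : ℝ)) P := by
    intro n
    rcases Nat.eq_zero_or_pos n with rfl | hn
    · simp
    · refine ((hint n hn).const_mul (t ^ n / (n.factorial : ℝ))).congr ?_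
      filter_upwards with ω
      ring
  have hc := cterm_hasSum (t * ε)
  have hsum : Summable fun n : ℕ => ∫ ω, ‖(t * X ω) ^ n / (n.factorial : ℝ)‖ ∂P := by
    simp_rw [fun n ω => Real.norm_of_nonneg (hnn n ω)]
    exact Summable.of_nonneg_of_le (fun n => integral_nonneg (hnn n)) hbound hc.summable
  have hS := hasSum_integral_of_summable_integral_norm hI hsum
  have hexp : ∀ ω, ∑' n : ℕ, (t * X ω) ^ n / (n.factorial : ℝ) = Real.exp (t * X ω) := by
    intro ω
    rw [Real.exp_eq_exp_ℝ]
    exact (NormedSpace.expSeries_div_hasSum_exp (t * X ω)).tsum_eq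
  simp_rw [hexp] at hS
  have := hasSum_le hbound hS hc
  rwa [mul_pow] at this
end

section
/- Let X be a nonnegative random variable and ε > 0 a constant such that for every integer p ≥ 1, E(X^p)^{1/p} ≤ B_p · ε, where B_{2p} = ((2p)!/(2^p·p!))^{1/(2p)} and B_{2p+1} = ((2p+1)!/(2^p·p!·√(2p+1)))^{1/(2p+1)}. Then for every s ≥ ε, P(X ≥ s) ≤ (s/ε) · e^{−((s/ε)² − 1)/2} = √e · (s/ε) · e^{−s²/(2ε²)}. -/
open MeasureTheory

lemma aux_step (p : ℕ) (hp : 1 ≤ p) (u : ℝ) (h1 : (p : ℝ) ≤ u) (h2 : u ≤ p + 1) :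
    (p : ℝ) ^ (p + 1) * Real.exp (-((p : ℝ) - 1)) ≤ u ^ (p + 1) * Real.exp (-(u - 1)) := by
  have hp' : (1 : ℝ) ≤ p := by exact_mod_cast hp
  have hu : 0 < u := by linarith
  have h3 : (p : ℝ) / u ≤ Real.exp (-((u - p) / u)) := by
    have := Real.add_one_le_exp (-((u - p) / u))
    have h : (p : ℝ) / u = -((u - p) / u) + 1 := by field_simp; ring
    rw [h]; exact this
  have h4 : ((p : ℝ) / u) ^ (p + 1) ≤ Real.exp (-(u - p)) := by
    calc ((p : ℝ) / u) ^ (p + 1) ≤ (Real.exp (-((u - p) / u))) ^ (p + 1) := by gcongr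
      _ = Real.exp ((p + 1 : ℕ) * (-((u - p) / u))) := by rw [Real.exp_nat_mul]
      _ ≤ Real.exp (-(u - p)) := by
        apply Real.exp_le_exp.mpr
        push_cast
        have h : ((p : ℝ) + 1) * (-((u - p) / u)) = -((u - p) * ((p + 1) / u)) := by
          field_simp
        rw [h]
        have : 1 ≤ ((p : ℝ) + 1) / u := by rw [le_div_iff₀ hu]; linarith
        nlinarith
  rw [div_pow, div_le_iff₀ (by positivity)] at h4
  calc (p : ℝ) ^ (p + 1) * Real.exp (-((p : ℝ) - 1))
      ≤ (Real.exp (-(u - p)) * u ^ (p + 1)) * Real.exp (-((p : ℝ) - 1)) := by gcongr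
    _ = u ^ (p + 1) * (Real.exp (-(u - p)) * Real.exp (-((p : ℝ) - 1))) := by ring
    _ = u ^ (p + 1) * Real.exp (-(u - 1)) := by rw [← Real.exp_add]; congr 2; ring

lemma aux_fact (p : ℕ) (hp : 1 ≤ p) :
    (p.factorial : ℝ) ≤ (p : ℝ) ^ (p + 1) * Real.exp (-((p : ℝ) - 1)) := by
  induction p, hp using Nat.le_induction with
  | base => simp
  | succ n hn ih =>
    have := aux_step n hn (n + 1) (by linarith) le_rfl
    rw [Nat.factorial_succ]
    push_cast
    calc ((n : ℝ) + 1) * n.factorial ≤ (n + 1) * (((n : ℝ) + 1) ^ (n + 1) * Real.exp (-((n : ℝ) + 1 - 1))) := by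
          gcongr; exact ih.trans this
      _ = _ := by ring

lemma aux_central (k : ℕ) : ((2 * k).factorial : ℝ) ≤ (2 ^ k * k.factorial) ^ 2 := by
  have h1 := Nat.choose_mul_factorial_mul_factorial (show k ≤ 2 * k by omega)
  have h2 : (2 * k).choose k ≤ 2 ^ (2 * k) := Nat.choose_le_two_pow _ _
  have : (2 * k).factorial ≤ (2 ^ k * k.factorial) ^ 2 := by
    rw [← h1, show 2 * k - k = k by omega]
    calc _ ≤ 2 ^ (2 * k) * k.factorial * k.factorial := by gcongr
      _ = _ := by ring
  exact_mod_cast this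

lemma aux_B (p : ℕ) (hp : 1 ≤ p) : 0 ≤ Bconst p ∧ (Bconst p ^ p) ^ 2 ≤ p.factorial := by
  have hp0 : p ≠ 0 := by omega
  unfold Bconst
  split_ifs with h
  · refine ⟨by positivity, ?_⟩
    rw [Real.rpow_inv_natCast_pow (by positivity) hp0]
    obtain ⟨k, rfl⟩ : ∃ k, p = 2 * k := ⟨p / 2, by omega⟩
    rw [show 2 * k / 2 = k by omega, div_pow, div_le_iff₀ (by positivity), sq]
    gcongr
    exact aux_central k
  · refine ⟨by positivity, ?_⟩
    rw [Real.rpow_inv_natCast_pow (by positivity) hp0]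
    obtain ⟨k, rfl⟩ : ∃ k, p = 2 * k + 1 := ⟨p / 2, by omega⟩
    rw [show (2 * k + 1) / 2 = k by omega, div_pow, div_le_iff₀ (by positivity), sq,
      mul_pow, Real.sq_sqrt (by positivity)]
    gcongr
    rw [Nat.factorial_succ, Nat.cast_mul, mul_comm]
    gcongr
    exact aux_central k

/-- If a nonnegative random variable `X` satisfies
`E(X^p)^{1/p} ≤ B_p · ε` for every `p ≥ 1`, then for every `s ≥ ε`,
`P(X ≥ s) ≤ (s/ε) e^{−((s/ε)² − 1)/2}`, a quantity equal to
`√e · (s/ε) · e^{−s²/(2ε²)}`. -/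
theorem concentration_bound {Ω : Type*} [MeasurableSpace Ω]
    (P : Measure Ω) [IsProbabilityMeasure P]
    (X : Ω → ℝ) (hXmeas : Measurable X) (hXnonneg : ∀ ω, 0 ≤ X ω)
    (ε : ℝ) (hε : 0 < ε)
    (hint : ∀ p : ℕ, 1 ≤ p → Integrable (fun ω => X ω ^ p) P)
    (hmom : ∀ p : ℕ, 1 ≤ p → (∫ ω, X ω ^ p ∂P) ^ ((p : ℝ)⁻¹) ≤ Bconst p * ε) :
    ∀ s : ℝ, ε ≤ s →
      (P {ω | s ≤ X ω}).toReal ≤ s / ε * Real.exp (-(((s / ε) ^ 2 - 1) / 2)) ∧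
      s / ε * Real.exp (-(((s / ε) ^ 2 - 1) / 2)) =
        Real.sqrt (Real.exp 1) * (s / ε) * Real.exp (-(s ^ 2 / (2 * ε ^ 2))) := by
  intro s hs
  have hs0 : 0 < s := hε.trans_le hs
  constructor
  · set t := s / ε with ht
    have ht1 : 1 ≤ t := by rw [ht, le_div_iff₀ hε]; linarith
    have ht0 : 0 < t := by linarith
    obtain ⟨p, hpdef⟩ : ∃ p : ℕ, p = ⌊t ^ 2⌋₊ := ⟨_, rfl⟩
    have hp : 1 ≤ p := by
      rw [hpdef]; apply Nat.le_floor; push_cast; nlinarith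
    have hp1 : (p : ℝ) ≤ t ^ 2 := by rw [hpdef]; exact Nat.floor_le (by positivity)
    have hp2 : t ^ 2 ≤ p + 1 := by rw [hpdef]; exact (Nat.lt_floor_add_one _).le
    obtain ⟨hB0, hB⟩ := aux_B p hp
    have hM : Bconst p ^ p ≤ t ^ (p + 1) * Real.exp (-((t ^ 2 - 1) / 2)) := by
      apply le_of_sq_le_sq _ (by positivity)
      refine hB.trans ((aux_fact p hp).trans ((aux_step p hp _ hp1 hp2).trans (le_of_eq ?_)))
      rw [mul_pow, ← Real.exp_nat_mul, ← pow_mul, ← pow_mul, mul_comm 2 (p + 1)]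
      congr 2
      push_cast
      ring
    have hI0 : 0 ≤ ∫ ω, X ω ^ p ∂P := integral_nonneg fun ω => pow_nonneg (hXnonneg ω) p
    have hI : ∫ ω, X ω ^ p ∂P ≤ (Bconst p * ε) ^ p := by
      have := pow_le_pow_left₀ (Real.rpow_nonneg hI0 _) (hmom p hp) p
      rwa [Real.rpow_inv_natCast_pow hI0 (by omega)] at this
    have hmk := mul_meas_ge_le_integral_of_nonneg
      (Filter.Eventually.of_forall fun ω => pow_nonneg (hXnonneg ω) p) (hint p hp) (s ^ p)
    have hset : {ω | s ^ p ≤ X ω ^ p} = {ω | s ≤ X ω} := by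
      ext ω
      exact pow_le_pow_iff_left₀ hs0.le (hXnonneg ω) (by omega)
    rw [hset] at hmk
    have hst : s = t * ε := by rw [ht]; field_simp
    have hfin : s ^ p * (P {ω | s ≤ X ω}).toReal
        ≤ s ^ p * (t * Real.exp (-((t ^ 2 - 1) / 2))) := by
      refine (hmk.trans hI).trans ?_
      rw [mul_pow]
      calc Bconst p ^ p * ε ^ p ≤ (t ^ (p + 1) * Real.exp (-((t ^ 2 - 1) / 2))) * ε ^ p := by gcongr
        _ = (t * ε) ^ p * (t * Real.exp (-((t ^ 2 - 1) / 2))) := by ring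
        _ = _ := by rw [← hst]
    exact le_of_mul_le_mul_left hfin (by positivity)
  · rw [show Real.sqrt (Real.exp 1) = Real.exp (1 / 2) from (Real.exp_half 1).symm,
      mul_comm (Real.exp (1 / 2)), mul_assoc, ← Real.exp_add]
    congr 2
    field_simp
    ring
end

section
/- Let X be a nonnegative random variable and ε > 0 a constant such that for every integer p ≥ 1, E(X^p)^{1/p} ≤ B_p · ε, where B_{2p} = ((2p)!/(2^p·p!))^{1/(2p)} and B_{2p+1} = ((2p+1)!/(2^p·p!·√(2p+1)))^{1/(2p+1)}. Then for every y ≥ 1, P(X ≥ 2ε(1 + √y)) ≤ e^{−y}. -/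
open MeasureTheory

lemma aux_fact_s17 (k : ℕ) : (2 * k).factorial ≤ 4 ^ k * k.factorial ^ 2 := by
  induction k with
  | zero => simp
  | succ n ih =>
    have h1 : (2 * (n + 1)).factorial = (2 * n + 2) * ((2 * n + 1) * (2 * n).factorial) := by
      rw [show 2 * (n + 1) = (2 * n + 1) + 1 by ring, Nat.factorial_succ, Nat.factorial_succ]
    rw [h1, Nat.factorial_succ]
    calc (2 * n + 2) * ((2 * n + 1) * (2 * n).factorial)
        ≤ (2 * n + 2) * ((2 * n + 2) * (4 ^ n * n.factorial ^ 2)) := by gcongr; omega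
      _ = 4 ^ (n + 1) * ((n + 1) * n.factorial) ^ 2 := by ring

lemma aux_B_s17 (k : ℕ) (hk : 1 ≤ k) : Bconst (2 * k) ^ (2 * k) ≤ 2 ^ k * (k.factorial : ℝ) := by
  unfold Bconst
  have h0 : 2 * k % 2 = 0 := by omega
  have h2 : 2 * k / 2 = k := by omega
  rw [if_pos h0, h2, Real.rpow_inv_natCast_pow (by positivity) (by omega),
    div_le_iff₀ (by positivity)]
  have := aux_fact_s17 k
  have h : ((2 * k).factorial : ℝ) ≤ 4 ^ k * (k.factorial : ℝ) ^ 2 := by exact_mod_cast this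
  calc _ ≤ _ := h
    _ = _ := by
      rw [show (4 : ℝ) = 2 * 2 by norm_num, mul_pow]; ring

lemma aux_mom {I b : ℝ} (hI : 0 ≤ I) (n : ℕ) (hn : n ≠ 0)
    (h : I ^ ((n : ℝ)⁻¹) ≤ b) : I ≤ b ^ n := by
  calc I = (I ^ ((n : ℝ)⁻¹)) ^ n := (Real.rpow_inv_natCast_pow hI hn).symm
    _ ≤ b ^ n := by gcongr

/-- If a nonnegative random variable `X` satisfies
`E(X^p)^{1/p} ≤ B_p · ε` for every `p ≥ 1`, then for every `y ≥ 1`,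
`P(X ≥ 2ε(1 + √y)) ≤ e^{−y}`. -/
theorem exponential_concentration_bound {Ω : Type*} [MeasurableSpace Ω]
    (P : Measure Ω) [IsProbabilityMeasure P]
    (X : Ω → ℝ) (hXmeas : Measurable X) (hXnonneg : ∀ ω, 0 ≤ X ω)
    (ε : ℝ) (hε : 0 < ε)
    (hint : ∀ p : ℕ, 1 ≤ p → Integrable (fun ω => X ω ^ p) P)
    (hmom : ∀ p : ℕ, 1 ≤ p → (∫ ω, X ω ^ p ∂P) ^ ((p : ℝ)⁻¹) ≤ Bconst p * ε) :
    ∀ y : ℝ, 1 ≤ y →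
      (P {ω | 2 * ε * (1 + Real.sqrt y) ≤ X ω}).toReal ≤ Real.exp (-y) := by
  intro y hy
  set Z : Ω → ℝ := fun ω => X ω ^ 2 / (4 * ε ^ 2) with hZ
  have hZ0 : ∀ ω, 0 ≤ Z ω := fun ω => by simp only [hZ]; positivity
  have hZm : Measurable Z := by fun_prop
  have key : ∀ k : ℕ, ∫⁻ ω, ENNReal.ofReal (Z ω ^ k / k.factorial) ∂P
      ≤ ENNReal.ofReal ((1 / 2) ^ k) := by
    intro k
    rcases Nat.eq_zero_or_pos k with rfl | hk
    · simp
    have hI0 : 0 ≤ ∫ ω, X ω ^ (2 * k) ∂P :=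
      integral_nonneg fun ω => pow_nonneg (hXnonneg ω) _
    have h1 := aux_mom hI0 (2 * k) (by omega) (hmom (2 * k) (by omega))
    have h2 : ∫ ω, X ω ^ (2 * k) ∂P ≤ 2 ^ k * (k.factorial : ℝ) * ε ^ (2 * k) := by
      refine h1.trans ?_
      rw [mul_pow]
      exact mul_le_mul_of_nonneg_right (aux_B_s17 k hk) (by positivity)
    have h3 : (fun ω => Z ω ^ k / k.factorial)
        = fun ω => X ω ^ (2 * k) * (1 / ((4 * ε ^ 2) ^ k * k.factorial)) := by
      funext ω
      simp only [hZ, div_pow, ← pow_mul]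
      field_simp
    rw [← ofReal_integral_eq_lintegral_ofReal]
    · apply ENNReal.ofReal_le_ofReal
      rw [h3, integral_mul_const]
      calc _ ≤ (2 ^ k * (k.factorial : ℝ) * ε ^ (2 * k)) *
              (1 / ((4 * ε ^ 2) ^ k * k.factorial)) := by gcongr
        _ = (1 / 2) ^ k := by
          rw [show (4 : ℝ) = 2 * 2 by norm_num, mul_pow, mul_pow, div_pow, one_pow, ← pow_mul]
          field_simp
    · rw [h3]
      exact (hint (2 * k) (by omega)).mul_const _
    · exact Filter.Eventually.of_forall fun ω => by
        have := hZ0 ω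
        simp only [Pi.zero_apply]
        positivity
  have hexp : ∫⁻ ω, ENNReal.ofReal (Real.exp (Z ω)) ∂P ≤ ENNReal.ofReal 2 := by
    have h1 : ∀ ω, ENNReal.ofReal (Real.exp (Z ω))
        = ∑' k : ℕ, ENNReal.ofReal (Z ω ^ k / k.factorial) := by
      intro ω
      rw [← ENNReal.ofReal_tsum_of_nonneg]
      · rw [Real.exp_eq_exp_ℝ, NormedSpace.exp_eq_tsum_div]
      · intro k
        have := hZ0 ω
        positivity
      · exact Real.summable_pow_div_factorial _
    simp_rw [h1]
    rw [lintegral_tsum (fun k => by fun_prop)]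
    refine (ENNReal.tsum_le_tsum key).trans ?_
    rw [← ENNReal.ofReal_tsum_of_nonneg (fun k => by positivity) summable_geometric_two,
      tsum_geometric_two]
  have hsub : {ω | 2 * ε * (1 + Real.sqrt y) ≤ X ω}
      ⊆ {ω | ENNReal.ofReal (Real.exp (y + 3)) ≤ ENNReal.ofReal (Real.exp (Z ω))} := by
    intro ω hω
    simp only [Set.mem_setOf_eq] at hω ⊢
    apply ENNReal.ofReal_le_ofReal
    apply Real.exp_le_exp.mpr
    simp only [hZ]
    rw [le_div_iff₀ (by positivity)]
    have hs : 1 ≤ Real.sqrt y := Real.one_le_sqrt.mpr hy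
    have hsq : Real.sqrt y ^ 2 = y := Real.sq_sqrt (by linarith)
    calc (y + 3) * (4 * ε ^ 2) ≤ (1 + Real.sqrt y) ^ 2 * (4 * ε ^ 2) := by
          gcongr; nlinarith
      _ = (2 * ε * (1 + Real.sqrt y)) ^ 2 := by ring
      _ ≤ X ω ^ 2 := by gcongr
  have hmk := mul_meas_ge_le_lintegral (μ := P)
    (f := fun ω => ENNReal.ofReal (Real.exp (Z ω))) (by fun_prop)
    (ENNReal.ofReal (Real.exp (y + 3)))
  have h4 : ENNReal.ofReal (Real.exp (y + 3)) * P {ω | 2 * ε * (1 + Real.sqrt y) ≤ X ω}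
      ≤ ENNReal.ofReal 2 :=
    (mul_le_mul_right (measure_mono hsub) _).trans (hmk.trans hexp)
  have h5 := ENNReal.toReal_mono ENNReal.ofReal_ne_top h4
  rw [ENNReal.toReal_mul, ENNReal.toReal_ofReal (Real.exp_pos _).le,
    ENNReal.toReal_ofReal (by norm_num)] at h5
  rw [Real.exp_neg, ← one_div, le_div_iff₀ (Real.exp_pos _)]
  rw [Real.exp_add] at h5
  have h6 : (2 : ℝ) ≤ Real.exp 3 := by
    have := Real.add_one_le_exp (3 : ℝ)
    linarith
  have h7 : 0 ≤ (P {ω | 2 * ε * (1 + Real.sqrt y) ≤ X ω}).toReal * Real.exp y := by positivity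
  nlinarith
end
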